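/- arXiv:2412.17976 — 2 statements merged into one kernel-verified Lean document; each statement's English description precedes it below -/
import Mathlib

section
/- Let Ω be a finite set with |Ω| > 9 and let G be a solvable subgroup of the symmetric group on Ω acting primitively on Ω. Then (G, Ω) is nice: there exist subsets Δ₁, Δ₂ of Ω with |Δ₁| < |Δ₂| and 2|Δ₂| ≤ |Ω| such that for j = 1, 2, the setwise stabilizer of Δ_j in G has a normal elementary abelian 3-subgroup (possibly trivial) with 2-group quotient. -/
open Pointwise

/-- A finite group `S` has the "required structure" if it has a (possibly trivial) normal
elementary abelian 3-subgroup `N` such that the quotient `S/N` is a 2-group. -/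
def RequiredStructure (S : Type*) [Group S] : Prop :=
  ∃ (N : Subgroup S) (hN : N.Normal),
    (∀ x ∈ N, ∀ y ∈ N, x * y = y * x) ∧ (∀ x ∈ N, x ^ 3 = 1) ∧
    @IsPGroup 2 (S ⧸ N) (@QuotientGroup.Quotient.group S _ N hN)

/-- A finite permutation group `(G, Ω)` is "nice" if there are subsets `Δ₁, Δ₂` of `Ω`
with `|Δ₁| < |Δ₂| ≤ |Ω|/2` whose setwise stabilizers in `G` both have the required
structure. -/
def IsNice (Ω : Type*) [Fintype Ω] (G : Subgroup (Equiv.Perm Ω)) : Prop :=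
  ∃ Δ₁ Δ₂ : Set Ω, Δ₁.ncard < Δ₂.ncard ∧ 2 * Δ₂.ncard ≤ Fintype.card Ω ∧
    RequiredStructure (MulAction.stabilizer G Δ₁) ∧
    RequiredStructure (MulAction.stabilizer G Δ₂)

/-- A permutation group `(G, Ω)` is primitive if it is transitive and every block is trivial. -/
def IsPrimitivePermGroup (Ω : Type*) [Fintype Ω] (G : Subgroup (Equiv.Perm Ω)) : Prop :=
  MulAction.IsPretransitive G Ω ∧
    ∀ B : Set Ω, MulAction.IsBlock G B → MulAction.IsTrivialBlock B

/-- A finite group that is not a 2-group extended by a Sylow 3-subgroup of order at most 3 contains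
elements of prime order at least 5, or many elements of 3-power order. -/
theorem requiredStructure_of_card_lt {S : Type*} [Group S] [Finite S]
    (h5 : ∀ r, r.Prime → 5 ≤ r → ∀ g : S, orderOf g ≠ r)
    (h3 : Nat.card {g : S // ∃ k, orderOf g = 3 ^ k} < 9) : RequiredStructure S := by
  have : Fact (Nat.Prime 3) := ⟨Nat.prime_three⟩
  have hpr : ∀ r, r.Prime → r ∣ Nat.card S → r = 2 ∨ r = 3 := by
    intro r hr hd
    have : Fact r.Prime := ⟨hr⟩
    obtain ⟨g, hg⟩ := exists_prime_orderOf_dvd_card' r hd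
    by_contra! hne
    have := hr.two_le
    have h4 : r ≠ 4 := by rintro rfl; exact absurd hr (by decide)
    exact h5 r hr (by omega) g hg
  have hsyl : ∀ Q : Sylow 3 S, ∀ x ∈ Q, ∃ k, orderOf x = 3 ^ k := by
    intro Q x hx
    obtain ⟨k, hk⟩ := (IsPGroup.iff_orderOf.mp Q.2) ⟨x, hx⟩
    exact ⟨k, by simpa using hk⟩
  have hcard_le : ∀ Q : Sylow 3 S, Nat.card Q = 1 ∨ Nat.card Q = 3 := by
    intro Q
    obtain ⟨m, hm⟩ := (IsPGroup.iff_card).mp Q.2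
    have hle : Nat.card Q ≤ Nat.card {g : S // ∃ k, orderOf g = 3 ^ k} :=
      Nat.card_le_card_of_injective (fun x : Q => ⟨x.1, hsyl Q x.1 x.2⟩) (by
        intro x y hxy
        exact Subtype.ext (by simpa using hxy))
    have hm2 : m < 2 := by
      by_contra! h
      have : 3 ^ 2 ≤ 3 ^ m := Nat.pow_le_pow_right (by norm_num) h
      have h' : Nat.card Q = 3 ^ m := hm
      omega
    have h' : Nat.card Q = 3 ^ m := hm
    interval_cases m
    · left; simpa using h'
    · right; simpa using h'
  have key : ∀ Q : Sylow 3 S, (Q : Subgroup S).Normal → RequiredStructure S := by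
    intro Q hQ
    refine ⟨Q, hQ, ?_, ?_, ?_⟩
    · intro x hx y hy
      have : IsCyclic Q := by
        rcases hcard_le Q with h | h
        · exact isCyclic_of_card_dvd_prime (p := 3) (by rw [h]; exact one_dvd _)
        · exact isCyclic_of_card_dvd_prime (p := 3) (by rw [h])
      have := mul_comm' (M := Q) ⟨x, hx⟩ ⟨y, hy⟩
      simpa using congrArg Subtype.val this
    · intro x hx
      have h1 : (⟨x, hx⟩ : (Q : Subgroup S)) ^ 3 = 1 := by
        rcases hcard_le Q with h | h
        · have := pow_card_eq_one' (x := (⟨x, hx⟩ : (Q : Subgroup S)))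
          rw [h] at this
          rw [pow_one] at this
          rw [this, one_pow]
        · have := pow_card_eq_one' (x := (⟨x, hx⟩ : (Q : Subgroup S)))
          rwa [h] at this
      simpa using congrArg Subtype.val h1
    · have hidx : ¬ 3 ∣ Nat.card (S ⧸ (Q : Subgroup S)) := Q.not_dvd_index
      refine IsPGroup.of_card (n := (Nat.card (S ⧸ (Q : Subgroup S))).primeFactorsList.length) ?_
      refine Nat.eq_prime_pow_of_unique_prime_dvd Nat.card_pos.ne' ?_
      intro d hd hdvd
      rcases hpr d hd (hdvd.trans (Subgroup.card_quotient_dvd_card _)) with h | h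
      · exact h
      · subst h; exact absurd hdvd hidx
  by_contra hbad
  have P : Sylow 3 S := default
  have hcard3 : ∀ Q : Sylow 3 S, Nat.card Q = 3 := by
    intro Q
    refine (hcard_le Q).resolve_left fun h => hbad (key Q ?_)
    have : (Q : Subgroup S) = ⊥ := Subgroup.eq_bot_of_card_eq _ h
    rw [this]; infer_instance
  have hnum : 4 ≤ Nat.card (Sylow 3 S) := by
    have h1 : Nat.card (Sylow 3 S) ≡ 1 [MOD 3] := card_sylow_modEq_one 3 S
    have h2 : Nat.card (Sylow 3 S) ≠ 1 := by
      intro h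
      have : Subsingleton (Sylow 3 S) := (Nat.card_eq_one_iff_unique.mp h).1
      exact hbad (key P (Sylow.normal_of_subsingleton P))
    have h3 : 0 < Nat.card (Sylow 3 S) := Nat.card_pos
    unfold Nat.ModEq at h1
    omega
  have hgen : ∀ Q : Sylow 3 S, ∃ q ∈ Q, q ≠ 1 ∧ Subgroup.zpowers q = Q ∧ orderOf q = 3 := by
    intro Q
    have hnt : Nontrivial Q := by
      rw [← Finite.one_lt_card_iff_nontrivial, hcard3 Q]; norm_num
    obtain ⟨⟨q, hq⟩, hq1⟩ := exists_ne (1 : Q)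
    have hq1' : q ≠ 1 := fun h => hq1 (Subtype.ext h)
    have ho : orderOf q = 3 := by
      have := orderOf_dvd_natCard (⟨q, hq⟩ : (Q : Subgroup S))
      rw [hcard3 Q, Subgroup.orderOf_mk] at this
      rcases (Nat.dvd_prime Nat.prime_three).mp this with h | h
      · exact absurd (orderOf_eq_one_iff.mp h) hq1'
      · exact h
    refine ⟨q, hq, hq1', ?_, ho⟩
    refine Subgroup.eq_of_le_of_card_ge ?_ ?_
    · rwa [Subgroup.zpowers_le]
    · rw [Nat.card_zpowers, ho]; exact (hcard3 Q).le
  choose q hqmem hq1 hqz hqo using hgen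
  have hqinj : Function.Injective q := by
    intro Q R h
    apply Sylow.ext
    rw [← hqz Q, ← hqz R, h]
  have hinv : ∀ Q R, q Q ≠ (q R)⁻¹ := by
    intro Q R h
    have : Q = R := by
      apply Sylow.ext
      rw [← hqz Q, ← hqz R, h, Subgroup.zpowers_inv]
    subst this
    have h2 : q Q ^ 2 = 1 := by
      rw [pow_two]; nth_rewrite 2 [h]; exact mul_inv_cancel _
    have := orderOf_dvd_of_pow_eq_one h2
    rw [hqo] at this
    omega
  let T := {g : S // ∃ k, orderOf g = 3 ^ k}
  let F : Option (Sylow 3 S ⊕ Sylow 3 S) → T := fun o =>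
    match o with
    | none => ⟨1, 0, by simp⟩
    | some (Sum.inl Q) => ⟨q Q, 1, by simp [hqo]⟩
    | some (Sum.inr Q) => ⟨(q Q)⁻¹, 1, by simp [hqo]⟩
  have hF : Function.Injective F := by
    rintro (_ | Q | Q) (_ | R | R) h <;> replace h := congrArg Subtype.val h <;>
      simp only [F] at h
    · rfl
    · exact absurd h.symm (hq1 R)
    · exact absurd (inv_eq_one.mp h.symm) (hq1 R)
    · exact absurd h (hq1 Q)
    · rw [hqinj h]
    · exact absurd h (hinv Q R)
    · exact absurd (inv_eq_one.mp h) (hq1 Q)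
    · exact absurd h.symm (hinv R Q)
    · rw [hqinj (inv_injective h)]
  have h9 := Nat.card_le_card_of_injective F hF
  rw [Finite.card_option, Nat.card_sum] at h9
  have : Nat.card T = Nat.card {g : S // ∃ k, orderOf g = 3 ^ k} := rfl
  omega

open MulAction in
/-- If all nontrivial orbits of `g` have size at least `c`, then `g` leaves invariant at most
`2 ^ (f + (N - f) / c)` subsets, where `f` is the number of fixed points of `g` among `N` points. -/
theorem card_invariant_sets_le {G Ω : Type*} [Group G] [MulAction G Ω] [Finite Ω] (g : G)
    {c : ℕ} (hc0 : 0 < c)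
    (hc : ∀ x : Ω, g • x ≠ x → c ≤ Nat.card (orbit (Subgroup.zpowers g) x)) :
    Nat.card {Δ : Set Ω // g • Δ = Δ} ≤
      2 ^ (Nat.card (fixedBy Ω g) + (Nat.card Ω - Nat.card (fixedBy Ω g)) / c) := by
  classical
  have := Fintype.ofFinite Ω
  let Q := orbitRel.Quotient (Subgroup.zpowers g) Ω
  let π : Ω → Q := Quotient.mk _
  have := Fintype.ofFinite Q
  have hinv : ∀ Δ : Set Ω, g • Δ = Δ → ∀ x y, π x = π y → x ∈ Δ → y ∈ Δ := by
    intro Δ hΔ x y hxy hx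
    have hr : y ∈ orbit (Subgroup.zpowers g) x := by
      have := Quotient.exact hxy.symm
      exact orbitRel_apply.mp this
    obtain ⟨k, rfl⟩ := hr
    have hk : k.1 ∈ stabilizer G Δ := by
      have : Subgroup.zpowers g ≤ stabilizer G Δ := by
        rw [Subgroup.zpowers_le]; exact hΔ
      exact this k.2
    have h2 : k.1 • Δ = Δ := hk
    change k.1 • x ∈ Δ
    rw [← h2]
    exact Set.smul_mem_smul_set hx
  have h1 : Nat.card {Δ : Set Ω // g • Δ = Δ} ≤ Nat.card (Set Q) := by
    refine Nat.card_le_card_of_injective (fun Δ => π '' Δ.1) ?_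
    intro Δ Γ h
    apply Subtype.ext
    ext x
    have hx : π x ∈ π '' Δ.1 ↔ π x ∈ π '' Γ.1 := by
      simp only at h; rw [h]
    have hm : ∀ Δ : {Δ : Set Ω // g • Δ = Δ}, π x ∈ π '' Δ.1 ↔ x ∈ Δ.1 := by
      intro Δ
      constructor
      · rintro ⟨y, hy, hyx⟩; exact hinv Δ.1 Δ.2 y x hyx hy
      · intro h; exact ⟨x, h, rfl⟩
    rwa [hm, hm] at hx
  refine h1.trans ?_
  rw [Nat.card_eq_fintype_card, Fintype.card_set]
  refine Nat.pow_le_pow_right (by norm_num) ?_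
  let F : Finset Ω := Finset.univ.filter fun x => g • x = x
  have hF : Nat.card (fixedBy Ω g) = F.card := by
    rw [Nat.card_eq_fintype_card, Fintype.card_subtype]
    rfl
  have hQ : Fintype.card Q ≤ (F.image π).card + (Fᶜ.image π).card := by
    rw [← Finset.card_univ]
    refine le_trans (Finset.card_le_card ?_) (Finset.card_union_le _ _)
    intro q _
    obtain ⟨x, rfl⟩ := Quotient.exists_rep q
    rw [← Finset.image_union, Finset.union_compl]
    exact Finset.mem_image_of_mem _ (Finset.mem_univ x)
  have h2 : (F.image π).card ≤ F.card := Finset.card_image_le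
  have h3 : c * (Fᶜ.image π).card ≤ Fᶜ.card := by
    refine Finset.mul_card_image_le_card _ _ ?_
    intro q hq
    obtain ⟨x, hx, rfl⟩ := Finset.mem_image.mp hq
    have hx' : g • x ≠ x := by simpa [F] using hx
    refine (hc x hx').trans ?_
    rw [Nat.card_eq_fintype_card, ← Set.toFinset_card]
    apply Finset.card_le_card
    intro y hy
    rw [Set.mem_toFinset] at hy
    obtain ⟨k, rfl⟩ := hy
    simp only [Finset.mem_filter, Finset.mem_compl, Finset.mem_univ, true_and, F]
    refine ⟨?_, Quotient.sound (orbitRel_apply.mpr ⟨k, rfl⟩)⟩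
    intro h
    apply hx'
    obtain ⟨k, m, rfl⟩ := k
    have hcomm : g • (g ^ m • x) = g ^ m • (g • x) := by
      rw [smul_smul, smul_smul, ← zpow_one_add, ← zpow_add_one, add_comm]
    have h' : g • (g ^ m • x) = g ^ m • x := h
    rw [hcomm] at h'
    exact smul_left_cancel _ h'
  have h4 : Fᶜ.card = Nat.card Ω - F.card := by
    rw [Finset.card_compl, Nat.card_eq_fintype_card]
  rw [hF, ← h4]
  have h5 : (Fᶜ.image π).card ≤ Fᶜ.card / c := by
    rw [Nat.le_div_iff_mul_le hc0, mul_comm]; exact h3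
  omega

open MulAction in
theorem card_invariant_sets_le_of_orderOf {G Ω : Type*} [Group G] [Finite G] [MulAction G Ω]
    [Finite Ω] (g : G) {r k : ℕ} (hr : r.Prime) (hg : orderOf g = r ^ k) :
    Nat.card {Δ : Set Ω // g • Δ = Δ} ≤
      2 ^ (Nat.card (fixedBy Ω g) + (Nat.card Ω - Nat.card (fixedBy Ω g)) / r) := by
  refine card_invariant_sets_le g hr.pos fun x hx => ?_
  have hd : Nat.card (orbit (Subgroup.zpowers g) x) ∣ r ^ k := by
    rw [← hg, ← Nat.card_zpowers, Nat.card_congr (orbitEquivQuotientStabilizer _ x)]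
    exact Subgroup.card_quotient_dvd_card _
  obtain ⟨j, -, hj⟩ := (Nat.dvd_prime_pow hr).mp hd
  rw [hj]
  rcases Nat.eq_zero_or_pos j with h0 | h0
  · exfalso
    subst h0
    have hs : Subsingleton (orbit (Subgroup.zpowers g) x) := by
      rw [pow_zero] at hj
      exact (Nat.card_eq_one_iff_unique.mp hj).1
    apply hx
    have := @Subsingleton.elim _ hs ⟨g • x, ⟨⟨g, Subgroup.mem_zpowers g⟩, rfl⟩⟩ ⟨x, mem_orbit_self x⟩
    exact congrArg Subtype.val this
  · calc r = r ^ 1 := (pow_one r).symm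
      _ ≤ r ^ j := Nat.pow_le_pow_right hr.pos h0

theorem four_mul_choose_le (n k : ℕ) (hn : 10 ≤ n) : 4 * n.choose k ≤ 2 ^ n := by
  induction n, hn using Nat.le_induction generalizing k with
  | base =>
    have h := Nat.choose_le_middle k 10
    have : Nat.choose 10 (10 / 2) = 252 := by decide
    omega
  | succ n _ ih =>
    cases k with
    | zero =>
      have := ih 0
      simp only [Nat.choose_zero_right] at this ⊢
      rw [pow_succ]; omega
    | succ k =>
      have h1 := ih k
      have h2 := ih (k + 1)
      rw [Nat.choose_succ_succ', pow_succ]; omega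

/-- If fewer than half of all subsets have a stabilizer without the required structure, then the
permutation group is nice. -/
theorem isNice_of_card_bad_lt {Ω : Type*} [Fintype Ω] (G : Subgroup (Equiv.Perm Ω))
    (hN : 10 ≤ Fintype.card Ω)
    (hbad : 2 * Nat.card {Δ : Set Ω // ¬ RequiredStructure (MulAction.stabilizer G Δ)} <
      2 ^ Fintype.card Ω) : IsNice Ω G := by
  classical
  set N := Fintype.card Ω with hNdef
  have hcompl : ∀ Δ : Set Ω, RequiredStructure (MulAction.stabilizer G Δ) →
      RequiredStructure (MulAction.stabilizer G Δᶜ) := by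
    intro Δ h
    rwa [stabilizer_compl]
  have hcardc : ∀ Δ : Set Ω, Δ.ncard + Δᶜ.ncard = N := by
    intro Δ
    rw [Set.ncard_add_ncard_compl, hNdef, Nat.card_eq_fintype_card]
  have hsmall : ∀ Δ : Set Ω, RequiredStructure (MulAction.stabilizer G Δ) →
      ∃ Γ : Set Ω, RequiredStructure (MulAction.stabilizer G Γ) ∧ 2 * Γ.ncard ≤ N ∧
        (Γ.ncard = Δ.ncard ∨ Γ.ncard + Δ.ncard = N) := by
    intro Δ h
    have := hcardc Δ
    by_cases hle : 2 * Δ.ncard ≤ N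
    · exact ⟨Δ, h, hle, Or.inl rfl⟩
    · exact ⟨Δᶜ, hcompl Δ h, by omega, Or.inr (by omega)⟩
  have hexists : ∀ k : ℕ, ∃ Δ : Set Ω, RequiredStructure (MulAction.stabilizer G Δ) ∧
      Δ.ncard ≠ k ∧ Δ.ncard + k ≠ N := by
    intro k
    by_contra! hno
    let B : Finset (Finset Ω) :=
      Finset.univ.filter fun s => ¬ RequiredStructure (MulAction.stabilizer G (s : Set Ω))
    have hBcard : B.card ≤
        Nat.card {Δ : Set Ω // ¬ RequiredStructure (MulAction.stabilizer G Δ)} := by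
      rw [← Fintype.card_coe, ← Nat.card_eq_fintype_card]
      refine Nat.card_le_card_of_injective
        (fun s => ⟨(s.1 : Set Ω), (Finset.mem_filter.mp s.2).2⟩) ?_
      intro s t h
      have := congrArg Subtype.val h
      exact Subtype.ext (Finset.coe_injective this)
    have hcover : (Finset.univ : Finset (Finset Ω)) ⊆ B ∪ (Finset.powersetCard k Finset.univ ∪
        Finset.powersetCard (N - k) Finset.univ) := by
      intro s _
      by_cases hs : RequiredStructure (MulAction.stabilizer G (s : Set Ω))
      · have h1 := hno s hs
        rw [Set.ncard_coe_finset] at h1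
        rw [Finset.mem_union, Finset.mem_union, Finset.mem_powersetCard, Finset.mem_powersetCard]
        right
        by_cases hk : s.card = k
        · left; exact ⟨Finset.subset_univ _, hk⟩
        · right; exact ⟨Finset.subset_univ _, by have := h1 hk; omega⟩
      · rw [Finset.mem_union]; left; simpa [B] using hs
    have h1 := Finset.card_le_card hcover
    have h2 := Finset.card_union_le B (Finset.powersetCard k Finset.univ ∪
        Finset.powersetCard (N - k) (Finset.univ : Finset Ω))
    have h3 := Finset.card_union_le (Finset.powersetCard k Finset.univ)
        (Finset.powersetCard (N - k) (Finset.univ : Finset Ω))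
    rw [Finset.card_powersetCard, Finset.card_powersetCard, Finset.card_univ, ← hNdef] at h3
    rw [Finset.card_univ, Fintype.card_finset, ← hNdef] at h1
    have h4 := four_mul_choose_le N k hN
    have h5 := four_mul_choose_le N (N - k) hN
    omega
  obtain ⟨Δ₁, h₁, -, -⟩ := hexists 0
  obtain ⟨Δ₂, h₂, hne, hne'⟩ := hexists Δ₁.ncard
  obtain ⟨Γ₁, hΓ₁, hle₁, hc₁⟩ := hsmall Δ₁ h₁
  obtain ⟨Γ₂, hΓ₂, hle₂, hc₂⟩ := hsmall Δ₂ h₂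
  have := hcardc Δ₁
  have := hcardc Δ₂
  rcases lt_trichotomy Γ₁.ncard Γ₂.ncard with h | h | h
  · exact ⟨Γ₁, Γ₂, h, hle₂, hΓ₁, hΓ₂⟩
  · omega
  · exact ⟨Γ₂, Γ₁, h, hle₁, hΓ₂, hΓ₁⟩

/-- A nontrivial element whose order is a power of an odd prime. -/
def IsOddPrimary {G : Type*} [Group G] (g : G) : Prop :=
  g ≠ 1 ∧ ∃ r k, r.Prime ∧ r ≠ 2 ∧ orderOf g = r ^ k

open scoped Classical in
/-- Weight used to count the odd primary elements of a stabilizer. -/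
noncomputable def oddWeight {G : Type*} [Group G] (g : G) : ℕ :=
  if ∃ k, orderOf g = 3 ^ k then 1 else if ∃ r, r.Prime ∧ 5 ≤ r ∧ orderOf g = r then 2 else 0

theorem oddWeight_of_prime {G : Type*} [Group G] {g : G} {r : ℕ} (hr : r.Prime) (h5 : 5 ≤ r)
    (hg : orderOf g = r) : oddWeight g = 2 := by
  have h3 : ¬ ∃ k, orderOf g = 3 ^ k := by
    rintro ⟨k, hk⟩
    have : r ∣ 3 ^ k := by rw [← hk, hg]
    have := (Nat.prime_dvd_prime_iff_eq hr Nat.prime_three).mp (hr.dvd_of_dvd_pow this)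
    omega
  rw [oddWeight, if_neg h3, if_pos ⟨r, hr, h5, hg⟩]

theorem oddWeight_of_three {G : Type*} [Group G] {g : G} {k : ℕ} (hg : orderOf g = 3 ^ k) :
    oddWeight g = 1 := by
  rw [oddWeight, if_pos ⟨k, hg⟩]

open scoped Classical in
theorem eight_le_sum_oddWeight {G : Type*} [Group G] [Fintype G] (S : Subgroup G)
    (hS : ¬ RequiredStructure S) :
    8 ≤ ∑ g ∈ Finset.univ.filter (fun g : G => IsOddPrimary g ∧ g ∈ S), oddWeight g := by
  by_cases h5 : ∀ r, r.Prime → 5 ≤ r → ∀ g : S, orderOf g ≠ r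
  · have h3 : 9 ≤ Nat.card {g : S // ∃ k, orderOf g = 3 ^ k} := by
      by_contra! h
      exact hS (requiredStructure_of_card_lt h5 h)
    let T : Finset G := Finset.univ.filter fun g => g ∈ S ∧ ∃ k, orderOf g = 3 ^ k
    have hT : Nat.card {g : S // ∃ k, orderOf g = 3 ^ k} ≤ T.card := by
      rw [← Fintype.card_coe, ← Nat.card_eq_fintype_card]
      refine Nat.card_le_card_of_injective
        (fun g => ⟨g.1.1, Finset.mem_filter.mpr ⟨Finset.mem_univ _, g.1.2, ?_⟩⟩) ?_
      · obtain ⟨k, hk⟩ := g.2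
        exact ⟨k, by rwa [Subgroup.orderOf_coe]⟩
      · intro g h hgh
        exact Subtype.ext (Subtype.ext (by simpa using hgh))
    have hT1 : T.card - 1 ≤ (T.erase 1).card := Finset.pred_card_le_card_erase
    calc 8 ≤ (T.erase 1).card := by omega
      _ = ∑ g ∈ T.erase 1, 1 := by simp
      _ = ∑ g ∈ T.erase 1, oddWeight g := by
        refine Finset.sum_congr rfl fun g hg => ?_
        obtain ⟨k, hk⟩ := (Finset.mem_filter.mp (Finset.mem_of_mem_erase hg)).2.2
        exact (oddWeight_of_three hk).symm
      _ ≤ _ := by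
        refine Finset.sum_le_sum_of_subset fun g hg => ?_
        obtain ⟨-, hgS, k, hk⟩ := Finset.mem_filter.mp (Finset.mem_of_mem_erase hg)
        exact Finset.mem_filter.mpr ⟨Finset.mem_univ _,
          ⟨Finset.ne_of_mem_erase hg, 3, k, Nat.prime_three, by norm_num, hk⟩, hgS⟩
  · push Not at h5
    obtain ⟨r, hr, hr5, s, hs⟩ := h5
    have hs' : orderOf (s : G) = r := by rwa [Subgroup.orderOf_coe]
    let T : Finset G := (Finset.range 4).image fun i => (s : G) ^ (i + 1)
    have hT : T.card = 4 := by
      rw [Finset.card_image_of_injOn, Finset.card_range]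
      intro i hi j hj hij
      have hi' := Finset.mem_range.mp hi
      have hj' := Finset.mem_range.mp hj
      have := pow_injOn_Iio_orderOf (x := (s : G)) (x₁ := i + 1) (x₂ := j + 1)
        (by simp [hs']; omega) (by simp [hs']; omega) hij
      omega
    have hTo : ∀ g ∈ T, orderOf g = r ∧ g ∈ S := by
      intro g hg
      obtain ⟨i, hi, rfl⟩ := Finset.mem_image.mp hg
      have hi' := Finset.mem_range.mp hi
      refine ⟨?_, S.pow_mem s.2 _⟩
      rw [Nat.Coprime.orderOf_pow, hs']
      rw [hs']
      exact (Nat.Prime.coprime_iff_not_dvd hr).mpr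
        (fun h => by have := Nat.le_of_dvd (by omega) h; omega)
    calc 8 = ∑ g ∈ T, 2 := by simp [hT]
      _ = ∑ g ∈ T, oddWeight g :=
        Finset.sum_congr rfl fun g hg => (oddWeight_of_prime hr hr5 (hTo g hg).1).symm
      _ ≤ _ := by
        refine Finset.sum_le_sum_of_subset fun g hg => ?_
        obtain ⟨h1, h2⟩ := hTo g hg
        refine Finset.mem_filter.mpr ⟨Finset.mem_univ _, ⟨?_, r, 1, hr, by omega, by simpa⟩, h2⟩
        rintro rfl
        rw [orderOf_one] at h1
        omega

open scoped Classical in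
theorem eight_mul_card_bad_le {G Ω : Type*} [Group G] [Fintype G] [MulAction G Ω] [Finite Ω]
    (hf : ∀ g : G, IsOddPrimary g → Nat.card (MulAction.fixedBy Ω g) + 8 ≤ Nat.card Ω) :
    8 * Nat.card {Δ : Set Ω // ¬ RequiredStructure (MulAction.stabilizer G Δ)} ≤
      ∑ g ∈ Finset.univ.filter (IsOddPrimary (G := G)), 2 ^ (Nat.card (MulAction.fixedBy Ω g) +
        (Nat.card Ω - Nat.card (MulAction.fixedBy Ω g)) / 3) := by
  have := Fintype.ofFinite Ω
  let B : Finset (Set Ω) :=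
    Finset.univ.filter fun Δ => ¬ RequiredStructure (MulAction.stabilizer G Δ)
  have hB : Nat.card {Δ : Set Ω // ¬ RequiredStructure (MulAction.stabilizer G Δ)} = B.card := by
    rw [Nat.card_eq_fintype_card, Fintype.card_subtype]
  have hterm : ∀ g : G, IsOddPrimary g →
      oddWeight g * Nat.card {Δ : Set Ω // g • Δ = Δ} ≤
        2 ^ (Nat.card (MulAction.fixedBy Ω g) +
          (Nat.card Ω - Nat.card (MulAction.fixedBy Ω g)) / 3) := by
    intro g hg
    have h8 := hf g hg
    by_cases h3 : ∃ k, orderOf g = 3 ^ k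
    · obtain ⟨k, hk⟩ := h3
      rw [oddWeight_of_three hk, one_mul]
      exact card_invariant_sets_le_of_orderOf g Nat.prime_three hk
    · by_cases h5 : ∃ r, r.Prime ∧ 5 ≤ r ∧ orderOf g = r
      · obtain ⟨r, hr, hr5, hgr⟩ := h5
        rw [oddWeight_of_prime hr hr5 hgr]
        have h1 := card_invariant_sets_le_of_orderOf (Ω := Ω) g hr (k := 1) (by simpa)
        set f := Nat.card (MulAction.fixedBy Ω g)
        set N := Nat.card Ω
        have h2 : (N - f) / r ≤ (N - f) / 5 := Nat.div_le_div_left hr5 (by norm_num)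
        calc _ ≤ 2 * 2 ^ (f + (N - f) / r) := Nat.mul_le_mul_left _ h1
          _ = 2 ^ (f + (N - f) / r + 1) := by rw [pow_succ, mul_comm]
          _ ≤ _ := Nat.pow_le_pow_right (by norm_num) (by omega)
      · rw [oddWeight, if_neg h3, if_neg h5, zero_mul]
        exact Nat.zero_le _
  calc 8 * Nat.card {Δ : Set Ω // ¬ RequiredStructure (MulAction.stabilizer G Δ)}
      = ∑ Δ ∈ B, 8 := by rw [hB, Finset.sum_const, smul_eq_mul, mul_comm]
    _ ≤ ∑ Δ ∈ B, ∑ g ∈ Finset.univ.filter (fun g : G => IsOddPrimary g ∧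
          g ∈ MulAction.stabilizer G Δ), oddWeight g :=
        Finset.sum_le_sum fun Δ hΔ => eight_le_sum_oddWeight _ (Finset.mem_filter.mp hΔ).2
    _ ≤ ∑ Δ : Set Ω, ∑ g ∈ Finset.univ.filter (fun g : G => IsOddPrimary g ∧
          g ∈ MulAction.stabilizer G Δ), oddWeight g :=
        Finset.sum_le_sum_of_subset (Finset.subset_univ _)
    _ = ∑ Δ : Set Ω, ∑ g ∈ Finset.univ.filter (IsOddPrimary (G := G)),
          if g • Δ = Δ then oddWeight g else 0 := by
        refine Finset.sum_congr rfl fun Δ _ => ?_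
        rw [← Finset.sum_filter, Finset.filter_filter]
        rfl
    _ = ∑ g ∈ Finset.univ.filter (IsOddPrimary (G := G)),
          oddWeight g * Nat.card {Δ : Set Ω // g • Δ = Δ} := by
        rw [Finset.sum_comm]
        refine Finset.sum_congr rfl fun g _ => ?_
        rw [← Finset.sum_filter, Finset.sum_const, smul_eq_mul, mul_comm,
          Nat.card_eq_fintype_card, Fintype.card_subtype]
    _ ≤ _ := Finset.sum_le_sum fun g hg => hterm g (Finset.mem_filter.mp hg).2

/-- A nontrivial finite solvable group has a nontrivial normal elementary abelian subgroup. -/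
theorem exists_normal_elementary_abelian (H : Type*) [Group H] [Finite H] [Nontrivial H]
    [Group.IsSolvable H] : ∃ (A : Subgroup H) (r : ℕ), A.Normal ∧ A ≠ ⊥ ∧ r.Prime ∧
      (∀ a ∈ A, ∀ b ∈ A, a * b = b * a) ∧ ∀ a ∈ A, a ^ r = 1 := by
  classical
  have hs : ∃ n, derivedSeries H n = ⊥ := (Group.isSolvable_def H).mp inferInstance
  obtain ⟨n, hn⟩ : ∃ n, Nat.find hs = n + 1 := by
    refine Nat.exists_eq_succ_of_ne_zero fun h => ?_
    have := Nat.find_spec hs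
    rw [h, derivedSeries_zero] at this
    exact top_ne_bot this
  have hD : derivedSeries H n ≠ ⊥ := Nat.find_min hs (by omega)
  have hD' : derivedSeries H (n + 1) = ⊥ := hn ▸ Nat.find_spec hs
  set D := derivedSeries H n with hDdef
  have hDn : D.Normal := by rw [hDdef]; infer_instance
  have hcomm : ∀ a ∈ D, ∀ b ∈ D, a * b = b * a := by
    intro a ha b hb
    rw [derivedSeries_succ] at hD'
    have h1 := Subgroup.commutator_mem_commutator ha hb
    rw [hD', Subgroup.mem_bot] at h1
    exact commutatorElement_eq_one_iff_mul_comm.mp h1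
  have hDnt : Nontrivial D := (Subgroup.nontrivial_iff_ne_bot D).mpr hD
  obtain ⟨r, hr, hrd⟩ := Nat.exists_prime_and_dvd (Finite.one_lt_card (α := D)).ne'
  have : Fact r.Prime := ⟨hr⟩
  obtain ⟨d, hd⟩ := exists_prime_orderOf_dvd_card' r hrd
  let A : Subgroup H :=
    { carrier := {a | a ∈ D ∧ a ^ r = 1}
      mul_mem' := fun {a b} ha hb => ⟨D.mul_mem ha.1 hb.1, by
        have hc : Commute a b := hcomm a ha.1 b hb.1
        rw [hc.mul_pow, ha.2, hb.2, one_mul]⟩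
      one_mem' := ⟨D.one_mem, one_pow r⟩
      inv_mem' := fun {a} ha => ⟨D.inv_mem ha.1, by rw [inv_pow, ha.2, inv_one]⟩ }
  refine ⟨A, r, ⟨?_⟩, ?_, hr, fun a ha b hb => hcomm a ha.1 b hb.1, fun a ha => ha.2⟩
  · intro a ha g
    exact ⟨hDn.conj_mem a ha.1 g, by rw [conj_pow, ha.2, mul_one, mul_inv_cancel]⟩
  · intro hA
    have hmem : (d : H) ∈ A := by
      refine ⟨d.2, ?_⟩
      rw [← Subgroup.coe_pow, ← hd, pow_orderOf_eq_one, Subgroup.coe_one]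
    rw [hA, Subgroup.mem_bot] at hmem
    have : d = 1 := Subtype.ext hmem
    rw [this, orderOf_one] at hd
    exact hr.one_lt.ne hd

open MulAction

theorem exists_smul_eq_of_normal {G Ω : Type*} [Group G] [MulAction G Ω] [FaithfulSMul G Ω]
    [IsPreprimitive G Ω] {V : Subgroup G} (hV : V.Normal) (hne : V ≠ ⊥) (x y : Ω) :
    ∃ v ∈ V, v • x = y := by
  have hfix : fixedPoints V Ω ≠ .univ := by
    intro h
    apply hne
    rw [Subgroup.eq_bot_iff_forall]
    intro v hv
    refine FaithfulSMul.eq_of_smul_eq_smul (α := Ω) fun a => ?_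
    have : a ∈ fixedPoints V Ω := h ▸ Set.mem_univ a
    rw [one_smul]
    exact this ⟨v, hv⟩
  have := IsQuasiPreprimitive.isPretransitive_of_normal hfix
  obtain ⟨v, hv⟩ := exists_smul_eq V x y
  exact ⟨v.1, v.2, hv⟩

/-- A solvable primitive permutation group is affine: the domain carries the structure of an
elementary abelian group on which point stabilizers act irreducibly. -/
theorem exists_affine_structure {G Ω : Type*} [Group G] [Finite G] [MulAction G Ω]
    [FaithfulSMul G Ω] [Nontrivial Ω] [Group.IsSolvable G] [IsPreprimitive G Ω] (x : Ω) :
    ∃ (p : ℕ) (_ : p.Prime) (_ : AddCommGroup Ω), (0 : Ω) = x ∧ (∀ a : Ω, p • a = 0) ∧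
      (∀ g ∈ stabilizer G x, ∀ a b : Ω, g • (a + b) = g • a + g • b) ∧
      ∀ U : AddSubgroup Ω, (∀ g ∈ stabilizer G x, ∀ a ∈ U, g • a ∈ U) → U = ⊥ ∨ U = ⊤ := by
  have hGnt : Nontrivial G := by
    by_contra h
    rw [not_nontrivial_iff_subsingleton] at h
    obtain ⟨a, b, hab⟩ := exists_pair_ne Ω
    obtain ⟨g, hg⟩ := exists_smul_eq G a b
    rw [Subsingleton.elim g 1, one_smul] at hg
    exact hab hg
  obtain ⟨V, p, hVn, hVne, hp, hVc, hVp⟩ := exists_normal_elementary_abelian G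
  have hfree : ∀ v ∈ V, v • x = x → v = 1 := by
    intro v hv hvx
    refine FaithfulSMul.eq_of_smul_eq_smul (α := Ω) fun a => ?_
    obtain ⟨u, hu, rfl⟩ := exists_smul_eq_of_normal hVn hVne x a
    rw [smul_smul, hVc v hv u hu, ← smul_smul, hvx, one_smul]
  have hbij : Function.Bijective fun v : V => v.1 • x := by
    constructor
    · intro u v huv
      have h1 : (v.1⁻¹ * u.1) • x = x := by
        rw [← smul_smul]
        exact inv_smul_eq_iff.mpr huv
      have := hfree _ (V.mul_mem (V.inv_mem v.2) u.2) h1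
      exact Subtype.ext (inv_mul_eq_one.mp this).symm
    · intro y
      obtain ⟨v, hv, hvy⟩ := exists_smul_eq_of_normal hVn hVne x y
      exact ⟨⟨v, hv⟩, hvy⟩
  let _ : CommGroup V :=
    { (inferInstance : Group V) with
      mul_comm := fun a b => Subtype.ext (hVc a.1 a.2 b.1 b.2) }
  let e : Ω ≃ Additive V := (Equiv.ofBijective _ hbij).symm.trans Additive.ofMul
  have he : ∀ v : V, e.symm (Additive.ofMul v) = v.1 • x := fun v => rfl
  let inst : AddCommGroup Ω := e.addCommGroup
  have hadd : ∀ (v : V) (b : Ω), v.1 • x + b = v.1 • b := by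
    intro v b
    obtain ⟨u, rfl⟩ := hbij.2 b
    change e.symm (e (v.1 • x) + e (u.1 • x)) = v.1 • u.1 • x
    rw [← he v, ← he u, Equiv.apply_symm_apply, Equiv.apply_symm_apply, ← ofMul_mul, he,
      he, smul_smul]
    rfl
  have hzero : (0 : Ω) = x := by
    change e.symm 0 = x
    rw [← ofMul_one, he, Subgroup.coe_one, one_smul]
  refine ⟨p, hp, inst, hzero, ?_, ?_, ?_⟩
  · intro a
    obtain ⟨u, rfl⟩ := hbij.2 a
    have hn : ∀ n : ℕ, n • (u.1 • x) = (u.1 ^ n) • x := by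
      intro n
      induction n with
      | zero => rw [zero_smul, pow_zero, one_smul, hzero]
      | succ n ih => rw [succ_nsmul', ih, hadd, smul_smul, ← pow_succ']
    simp only
    rw [hn, hVp u.1 u.2, one_smul, hzero]
  · intro g hg a b
    obtain ⟨u, rfl⟩ := hbij.2 a
    have hgx : g⁻¹ • x = x := inv_smul_eq_iff.mpr (mem_stabilizer_iff.mp hg).symm
    have h1 : g • u.1 • x = (g * u.1 * g⁻¹) • x := by
      rw [← smul_smul, hgx, ← smul_smul]
    have h2 := hadd ⟨g * u.1 * g⁻¹, hVn.conj_mem _ u.2 g⟩ (g • b)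
    simp only at h2 ⊢
    rw [hadd, h1, h2, smul_smul, smul_smul, inv_mul_cancel_right]
  · intro U hU
    by_cases hUb : U = ⊥
    · exact Or.inl hUb
    right
    let M : Subgroup G :=
      { carrier := {g | g ∈ V ∧ g • x ∈ U}
        mul_mem' := fun {a b} ha hb => ⟨V.mul_mem ha.1 hb.1, by
          rw [← smul_smul, ← hadd ⟨a, ha.1⟩]
          exact U.add_mem ha.2 hb.2⟩
        one_mem' := ⟨V.one_mem, by rw [one_smul, ← hzero]; exact U.zero_mem⟩
        inv_mem' := fun {a} ha => ⟨V.inv_mem ha.1, by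
          have h1 : a • x + a⁻¹ • x = 0 := by
            rw [hadd ⟨a, ha.1⟩, smul_inv_smul, hzero]
          rw [← neg_eq_of_add_eq_zero_right h1]
          exact U.neg_mem ha.2⟩ }
    have hMn : M.Normal := by
      refine ⟨fun m hm g => ⟨hVn.conj_mem m hm.1 g, ?_⟩⟩
      obtain ⟨v, hv, hvx⟩ := exists_smul_eq_of_normal hVn hVne x (g • x)
      have hh : v⁻¹ * g ∈ stabilizer G x := by
        rw [mem_stabilizer_iff, ← smul_smul, ← hvx, inv_smul_smul]
      have hhx : (v⁻¹ * g)⁻¹ • x = x := inv_smul_eq_iff.mpr (mem_stabilizer_iff.mp hh).symm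
      have hc : g * m * g⁻¹ = (v⁻¹ * g) * m * (v⁻¹ * g)⁻¹ := by
        have h1 := hVc v⁻¹ (V.inv_mem hv) _ (hVn.conj_mem m hm.1 g)
        calc g * m * g⁻¹ = (g * m * g⁻¹) * v⁻¹ * v := by group
          _ = v⁻¹ * (g * m * g⁻¹) * v := by rw [h1]
          _ = _ := by group
      rw [hc, ← smul_smul, hhx, ← smul_smul]
      exact hU _ hh _ hm.2
    have hMne : M ≠ ⊥ := by
      intro hM
      apply hUb
      rw [AddSubgroup.eq_bot_iff_forall]
      intro a ha
      obtain ⟨u, rfl⟩ := hbij.2 a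
      have : u.1 ∈ M := ⟨u.2, ha⟩
      rw [hM, Subgroup.mem_bot] at this
      simp only
      rw [this, one_smul, hzero]
    rw [AddSubgroup.eq_top_iff']
    intro a
    obtain ⟨m, hm, rfl⟩ := exists_smul_eq_of_normal hMn hMne x a
    exact hm.2

section Linear

variable {W H : Type*} [AddCommGroup W] [Group H] [DistribMulAction H W]

/-- The additive subgroup of points fixed by a single element. -/
def fixedAddSubgroup (W : Type*) [AddCommGroup W] [DistribMulAction H W] (h : H) :
    AddSubgroup W where
  carrier := fixedBy W h
  add_mem' {a b} ha hb := by
    rw [mem_fixedBy] at *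
    rw [smul_add, ha, hb]
  zero_mem' := smul_zero h
  neg_mem' {a} ha := by
    rw [mem_fixedBy] at *
    rw [smul_neg, ha]

theorem mem_fixedAddSubgroup {h : H} {a : W} : a ∈ fixedAddSubgroup W h ↔ h • a = a :=
  Iff.rfl

theorem card_fixedBy_eq (h : H) :
    Nat.card (fixedBy W h) = Nat.card (fixedAddSubgroup W h) :=
  rfl

theorem eq_one_of_fixedAddSubgroup_eq_top [FaithfulSMul H W] {h : H}
    (hh : fixedAddSubgroup W h = ⊤) : h = 1 :=
  FaithfulSMul.eq_of_smul_eq_smul fun a : W => by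
    rw [one_smul]
    exact mem_fixedAddSubgroup.mp (hh ▸ AddSubgroup.mem_top a)

theorem exists_card_fixedBy_eq_pow {p n : ℕ} (hp : p.Prime) (hn : Nat.card W = p ^ n) (h : H) :
    ∃ j ≤ n, Nat.card (fixedBy W h) = p ^ j := by
  rw [card_fixedBy_eq]
  exact (Nat.dvd_prime_pow hp).mp (hn ▸ AddSubgroup.card_addSubgroup_dvd_card _)

variable [Finite W]

/-- A finite abelian group of prime exponent has prime power order. -/
theorem exists_card_eq_prime_pow {p : ℕ} (hp : p.Prime) (hpW : ∀ a : W, p • a = 0) :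
    ∃ n, Nat.card W = p ^ n := by
  have : Fact p.Prime := ⟨hp⟩
  obtain ⟨_⟩ : Nonempty (Module (ZMod p) W) := ⟨AddCommGroup.zmodModule hpW⟩
  exact ⟨Module.finrank (ZMod p) W, by
    rw [Module.natCard_eq_pow_finrank (K := ZMod p), Nat.card_zmod]⟩

theorem finrank_zmod_eq {p n : ℕ} [Fact p.Prime] [Module (ZMod p) W]
    (hn : Nat.card W = p ^ n) : Module.finrank (ZMod p) W = n := by
  rw [Module.natCard_eq_pow_finrank (K := ZMod p) (V := W), Nat.card_zmod] at hn
  exact Nat.pow_right_injective (Fact.out : p.Prime).two_le hn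

theorem exists_card_fixedBy_eq_pow_lt [FaithfulSMul H W] {p n : ℕ} (hp : p.Prime)
    (hn : Nat.card W = p ^ n) {h : H} (hh : h ≠ 1) :
    ∃ j < n, Nat.card (fixedBy W h) = p ^ j := by
  obtain ⟨j, hj, hc⟩ := exists_card_fixedBy_eq_pow hp hn h
  refine ⟨j, lt_of_le_of_ne hj ?_, hc⟩
  rintro rfl
  refine hh (eq_one_of_fixedAddSubgroup_eq_top (W := W) ?_)
  rw [← AddSubgroup.card_eq_iff_eq_top, hn, ← hc, card_fixedBy_eq]

/-- An element of odd order cannot fix a hyperplane over the field with two elements. -/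
theorem exists_card_fixedBy_eq_two_pow [FaithfulSMul H W] {n : ℕ}
    (hn : Nat.card W = 2 ^ n) {h : H} (hh : ¬ h ^ 2 = 1) :
    ∃ j, j + 2 ≤ n ∧ Nat.card (fixedBy W h) = 2 ^ j := by
  obtain ⟨j, hj, hc⟩ := exists_card_fixedBy_eq_pow_lt (H := H) Nat.prime_two hn
    (h := h) (by rintro rfl; exact hh (one_pow 2))
  refine ⟨j, ?_, hc⟩
  by_contra hlt
  obtain rfl : n = j + 1 := by omega
  have hidx : (fixedAddSubgroup W h).index = 2 := by
    have h1 := (fixedAddSubgroup W h).card_mul_index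
    rw [← card_fixedBy_eq, hc, hn, pow_succ] at h1
    exact Nat.eq_of_mul_eq_mul_left (by positivity) h1
  refine hh (FaithfulSMul.eq_of_smul_eq_smul fun a : W => ?_)
  rw [one_smul, pow_two, mul_smul]
  have h3 : h • a + a ∈ fixedAddSubgroup W h := by
    rw [AddSubgroup.add_mem_iff_of_index_two hidx]
    simp only [mem_fixedAddSubgroup, smul_left_cancel_iff]
  rw [mem_fixedAddSubgroup, smul_add, add_comm] at h3
  exact add_left_cancel h3

/-- A faithful linear group of dimension `n` has order at most `|W| ^ n`. -/
theorem card_le_card_pow [FaithfulSMul H W] {p n : ℕ} (hp : p.Prime) (hpW : ∀ a : W, p • a = 0)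
    (hn : Nat.card W = p ^ n) : Nat.card H ≤ (p ^ n) ^ n := by
  have : Fact p.Prime := ⟨hp⟩
  obtain ⟨_⟩ : Nonempty (Module (ZMod p) W) := ⟨AddCommGroup.zmodModule hpW⟩
  have hfr := finrank_zmod_eq (W := W) hn
  let b : Module.Basis (Fin n) (ZMod p) W := Module.finBasisOfFinrankEq (ZMod p) W hfr
  have hinj : Function.Injective fun (h : H) (i : Fin n) => h • b i := by
    intro g h hgh
    refine FaithfulSMul.eq_of_smul_eq_smul fun a : W => ?_
    have : (DistribSMul.toAddMonoidHom W g).toZModLinearMap p =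
        (DistribSMul.toAddMonoidHom W h).toZModLinearMap p :=
      b.ext fun i => congrFun hgh i
    exact LinearMap.congr_fun this a
  calc Nat.card H ≤ Nat.card (Fin n → W) := Nat.card_le_card_of_injective _ hinj
    _ = (p ^ n) ^ n := by rw [Nat.card_fun, hn, Nat.card_fin]

theorem card_le_card_GL [FaithfulSMul H W] {p n : ℕ} (hp : p.Prime) (hpW : ∀ a : W, p • a = 0)
    (hn : Nat.card W = p ^ n) : Nat.card H ≤ ∏ i : Fin n, (p ^ n - p ^ (i : ℕ)) := by
  have : Fact p.Prime := ⟨hp⟩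
  obtain ⟨_⟩ : Nonempty (Module (ZMod p) W) := ⟨AddCommGroup.zmodModule hpW⟩
  have hfr := finrank_zmod_eq (W := W) hn
  let b : Module.Basis (Fin n) (ZMod p) W := Module.finBasisOfFinrankEq (ZMod p) W hfr
  have hinj : ∀ g h : H, (DistribSMul.toAddMonoidHom W g).toZModLinearMap p =
        (DistribSMul.toAddMonoidHom W h).toZModLinearMap p → g = h := fun g h hgh =>
    FaithfulSMul.eq_of_smul_eq_smul fun a : W => LinearMap.congr_fun hgh a
  let φ : H →* Module.End (ZMod p) W :=
    { toFun := fun h => (DistribSMul.toAddMonoidHom W h).toZModLinearMap p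
      map_one' := LinearMap.ext (one_smul H)
      map_mul' := fun g h => LinearMap.ext fun a => by
        change (g * h) • a = g • h • a
        exact mul_smul g h a }
  let ψ : H →* (Matrix (Fin n) (Fin n) (ZMod p))ˣ :=
    (((LinearMap.toMatrixAlgEquiv b : Module.End (ZMod p) W ≃ₐ[ZMod p] _) : Module.End (ZMod p) W →* _).comp φ).toHomUnits
  have hψ : Function.Injective ψ := by
    intro g h hgh
    exact hinj g h ((LinearMap.toMatrixAlgEquiv b).injective (congrArg Units.val hgh))
  have := Nat.card_le_card_of_injective ψ hψ
  rwa [Matrix.card_GL_field, ZMod.card] at this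

/-- The number of elements of a linear group whose fixed space has codimension `d`. -/
theorem card_fixedBy_eq_le [FaithfulSMul H W] {p n d : ℕ} (hp : p.Prime)
    (hpW : ∀ a : W, p • a = 0) (hn : Nat.card W = p ^ (n + d)) :
    Nat.card {h : H // Nat.card (fixedBy W h) = p ^ n} ≤ p ^ (2 * ((n + d) * d)) := by
  have : Fact p.Prime := ⟨hp⟩
  obtain ⟨_⟩ : Nonempty (Module (ZMod p) W) := ⟨AddCommGroup.zmodModule hpW⟩
  have hfr := finrank_zmod_eq (W := W) hn
  let φ : H → (W →ₗ[ZMod p] W) := fun h =>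
    (DistribSMul.toAddMonoidHom W h - AddMonoidHom.id W).toZModLinearMap p
  have hφ : ∀ h a, φ h a = h • a - a := fun h a => rfl
  have hrank : ∀ h : H, Nat.card (fixedBy W h) = p ^ n →
      Module.finrank (ZMod p) (LinearMap.range (φ h)) = d := by
    intro h hh
    have h1 : Nat.card (LinearMap.ker (φ h)) = p ^ n := by
      rw [← hh]
      refine Nat.card_congr (Equiv.subtypeEquivRight fun a => ?_)
      rw [LinearMap.mem_ker, hφ, sub_eq_zero, mem_fixedBy]
    have h2 := finrank_zmod_eq (W := LinearMap.ker (φ h)) h1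
    have h3 := LinearMap.finrank_range_add_finrank_ker (φ h)
    omega
  have hfac : ∀ h : {h : H // Nat.card (fixedBy W h) = p ^ n},
      ∃ AB : (W →ₗ[ZMod p] (Fin d → ZMod p)) × ((Fin d → ZMod p) →ₗ[ZMod p] W),
        AB.2 ∘ₗ AB.1 = φ h := by
    rintro ⟨h, hh⟩
    let e := (Module.finBasisOfFinrankEq (ZMod p) _ (hrank h hh)).equivFun
    refine ⟨(e.toLinearMap ∘ₗ (φ h).rangeRestrict,
      (LinearMap.range (φ h)).subtype ∘ₗ e.symm.toLinearMap), LinearMap.ext fun a => ?_⟩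
    simp
  choose F hF using hfac
  have hinj : Function.Injective F := by
    intro g h hgh
    have h1 : φ g = φ h := by rw [← hF, hgh, hF]
    refine Subtype.ext (FaithfulSMul.eq_of_smul_eq_smul fun a : W => ?_)
    have h2 := LinearMap.congr_fun h1 a
    rw [hφ, hφ] at h2
    exact sub_left_injective h2
  have hfin1 : Finite (W →ₗ[ZMod p] (Fin d → ZMod p)) := Module.finite_of_finite (ZMod p)
  have hfin2 : Finite ((Fin d → ZMod p) →ₗ[ZMod p] W) := Module.finite_of_finite (ZMod p)
  refine (Nat.card_le_card_of_injective F hinj).trans_eq ?_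
  rw [Nat.card_prod, Module.natCard_eq_pow_finrank (K := ZMod p),
    Module.natCard_eq_pow_finrank (K := ZMod p) (V := (Fin d → ZMod p) →ₗ[ZMod p] W),
    Module.finrank_linearMap, Module.finrank_linearMap, hfr, Module.finrank_fin_fun,
    Nat.card_zmod, ← pow_add]
  congr 1
  ring

end Linear

section Counting

variable {G Ω : Type*} [Group G] [MulAction G Ω]

theorem card_fixedBy_conj (g t : G) :
    Nat.card (fixedBy Ω (t * g * t⁻¹)) = Nat.card (fixedBy Ω g) := by
  refine Nat.card_congr ((MulAction.toPerm t⁻¹).subtypeEquiv fun a => ?_)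
  simp only [mem_fixedBy, MulAction.toPerm_apply, mul_smul]
  rw [← eq_inv_smul_iff]

theorem isOddPrimary_conj {g : G} (hg : IsOddPrimary g) (t : G) : IsOddPrimary (t * g * t⁻¹) := by
  obtain ⟨h1, r, k, hr, hr2, ho⟩ := hg
  exact ⟨by rwa [Ne, conj_eq_one_iff], r, k, hr, hr2, by
    rw [← ho]
    exact orderOf_injective (MulAut.conj t).toMonoidHom (MulAut.conj t).injective g⟩

/-- An element with a fixed point is conjugate to an element of a given point stabilizer. -/
theorem exists_conj_mem_stabilizer [IsPretransitive G Ω] (x : Ω) {g : G}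
    (hg : Nat.card (fixedBy Ω g) ≠ 0) : ∃ t : G, t * g * t⁻¹ ∈ stabilizer G x := by
  obtain ⟨⟨y, hy⟩⟩ := (Nat.card_ne_zero.mp hg).1
  obtain ⟨t, rfl⟩ := exists_smul_eq G y x
  refine ⟨t, ?_⟩
  rw [mem_stabilizer_iff, mul_smul, mul_smul, inv_smul_smul, hy]

/-- Double counting the fixed points of the elements in a union of conjugacy classes. -/
theorem sum_card_fixedBy_eq [Fintype G] [Finite Ω] [IsPretransitive G Ω] (P : G → Prop)
    [DecidablePred P] (hP : ∀ g t, P g → P (t * g * t⁻¹)) (x : Ω) :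
    ∑ g with P g, Nat.card (fixedBy Ω g) =
      Nat.card Ω * Nat.card {h : stabilizer G x // P h} := by
  classical
  have := Fintype.ofFinite Ω
  have hconj : ∀ y : Ω, (Finset.univ.filter fun g : G => P g ∧ g • y = y).card =
      Nat.card {h : stabilizer G x // P h} := by
    intro y
    obtain ⟨t, rfl⟩ := exists_smul_eq G x y
    rw [← Fintype.card_subtype, ← Nat.card_eq_fintype_card]
    refine Nat.card_congr
      { toFun := fun g => ⟨⟨t⁻¹ * g.1 * t, by
          rw [mem_stabilizer_iff, mul_smul, mul_smul, g.2.2, inv_smul_smul]⟩, by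
          simpa using hP g.1 t⁻¹ g.2.1⟩
        invFun := fun h => ⟨t * h.1.1 * t⁻¹, hP _ _ h.2, by
          rw [mul_smul, mul_smul, inv_smul_smul, mem_stabilizer_iff.mp h.1.2]⟩
        left_inv := fun g => Subtype.ext (by simp only; group)
        right_inv := fun h => Subtype.ext (Subtype.ext (by simp only; group)) }
  calc ∑ g with P g, Nat.card (fixedBy Ω g)
      = ∑ g with P g, ∑ y : Ω, if g • y = y then 1 else 0 := by
        refine Finset.sum_congr rfl fun g _ => ?_
        rw [Finset.sum_boole, Nat.card_eq_fintype_card, Fintype.card_subtype]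
        rfl
    _ = ∑ y : Ω, ∑ g with P g, if g • y = y then 1 else 0 := Finset.sum_comm
    _ = ∑ y : Ω, Nat.card {h : stabilizer G x // P h} := by
        refine Finset.sum_congr rfl fun y _ => ?_
        rw [Finset.sum_boole, Finset.filter_filter, hconj]
        rfl
    _ = _ := by rw [Finset.sum_const, smul_eq_mul, Finset.card_univ,
          Nat.card_eq_fintype_card (α := Ω)]

/-- The weights of the elements in a union of conjugacy classes are bounded by counting
fixed points. -/
theorem sum_weight_le [Fintype G] [Finite Ω] [IsPretransitive G Ω] (P : G → Prop)
    [DecidablePred P] (hP : ∀ g t, P g → P (t * g * t⁻¹)) (x : Ω) (w : ℕ → ℕ) (M : ℕ)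
    (hM : ∀ g, P g → w (Nat.card (fixedBy Ω g)) ≤ M * Nat.card (fixedBy Ω g)) :
    ∑ g with P g, w (Nat.card (fixedBy Ω g)) ≤
      M * (Nat.card Ω * Nat.card {h : stabilizer G x // P h}) := by
  rw [← sum_card_fixedBy_eq P hP x, Finset.mul_sum]
  exact Finset.sum_le_sum fun g hg => hM g (Finset.mem_filter.mp hg).2

theorem card_eq_card_mul_card_stabilizer [Finite G] [IsPretransitive G Ω] (x : Ω) :
    Nat.card G = Nat.card Ω * Nat.card (stabilizer G x) := by
  rw [← index_stabilizer_of_transitive G x, mul_comm, Subgroup.card_mul_index]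

end Counting

/-- Upper bound for the number of subsets of an `N`-element set invariant under a permutation
with `f` fixed points all of whose other cycles have length at least three. -/
def fixWeight (N f : ℕ) : ℕ := 2 ^ (f + (N - f) / 3)

theorem fixWeight_mono {N f m : ℕ} (hfm : f ≤ m) (hm : m ≤ N) : fixWeight N f ≤ fixWeight N m :=
  Nat.pow_le_pow_right two_pos (by omega)

open scoped Classical in
/-- The total weight of the odd primary elements of a permutation group. -/
noncomputable def oddFixWeight (G Ω : Type*) [Group G] [Fintype G] [MulAction G Ω] : ℕ :=
  ∑ g : G with IsOddPrimary g, fixWeight (Nat.card Ω) (Nat.card (fixedBy Ω g))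

theorem isNice_of_oddFixWeight_lt {Ω : Type*} [Fintype Ω] (G : Subgroup (Equiv.Perm Ω))
    [Fintype G] (hN : 10 ≤ Nat.card Ω)
    (hf : ∀ g : G, IsOddPrimary g → Nat.card (fixedBy Ω g) + 8 ≤ Nat.card Ω)
    (hG : oddFixWeight G Ω < 2 ^ (Nat.card Ω + 2)) : IsNice Ω G := by
  have h1 := (eight_mul_card_bad_le hf).trans_lt hG
  rw [Nat.card_eq_fintype_card (α := Ω)] at hN h1
  refine isNice_of_card_bad_lt G hN ?_
  rw [pow_add] at h1
  omega

section Weight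

variable {G Ω : Type*} [Group G] [Fintype G] [MulAction G Ω]

theorem oddFixWeight_le {m : ℕ} (hm : m ≤ Nat.card Ω)
    (hf : ∀ g : G, IsOddPrimary g → Nat.card (fixedBy Ω g) ≤ m) :
    oddFixWeight G Ω ≤ Nat.card G * fixWeight (Nat.card Ω) m := by
  classical
  calc oddFixWeight G Ω ≤ ∑ g : G with IsOddPrimary g, fixWeight (Nat.card Ω) m :=
        Finset.sum_le_sum fun g hg => fixWeight_mono (hf g (Finset.mem_filter.mp hg).2) hm
    _ ≤ ∑ g : G, fixWeight (Nat.card Ω) m :=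
        Finset.sum_le_sum_of_subset (Finset.filter_subset _ _)
    _ = _ := by
        rw [Finset.sum_const, smul_eq_mul, Finset.card_univ, Nat.card_eq_fintype_card (α := G)]

/-- If every odd primary element has a fixed point, only point stabilizers matter. -/
theorem oddFixWeight_le_of_forall_le [Finite Ω] [IsPretransitive G Ω] (x : Ω) {M : ℕ}
    (hM : ∀ g : G, IsOddPrimary g →
      fixWeight (Nat.card Ω) (Nat.card (fixedBy Ω g)) ≤ M * Nat.card (fixedBy Ω g)) :
    oddFixWeight G Ω ≤
      M * (Nat.card Ω * Nat.card {h : stabilizer G x // IsOddPrimary (h : G)}) := by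
  classical
  exact sum_weight_le IsOddPrimary (fun g t hg => isOddPrimary_conj hg t) x _ M hM

/-- Splitting the odd primary elements according to whether they have no fixed points,
exactly `m` fixed points, or another number of fixed points. -/
theorem oddFixWeight_le_add [Finite Ω] [IsPretransitive G Ω] (x : Ω) (m : ℕ) {M₁ M₂ : ℕ}
    (hM₁ : fixWeight (Nat.card Ω) m ≤ M₁ * m)
    (hM₂ : ∀ g : G, IsOddPrimary g → Nat.card (fixedBy Ω g) ≠ 0 → Nat.card (fixedBy Ω g) ≠ m →
      fixWeight (Nat.card Ω) (Nat.card (fixedBy Ω g)) ≤ M₂ * Nat.card (fixedBy Ω g)) :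
    oddFixWeight G Ω ≤ Nat.card G * fixWeight (Nat.card Ω) 0 +
      M₁ * (Nat.card Ω * Nat.card {h : stabilizer G x // Nat.card (fixedBy Ω h) = m}) +
      M₂ * (Nat.card Ω * Nat.card (stabilizer G x)) := by
  classical
  let w : G → ℕ := fun g => fixWeight (Nat.card Ω) (Nat.card (fixedBy Ω g))
  let P₁ : G → Prop := fun g => Nat.card (fixedBy Ω g) = m
  let P₂ : G → Prop := fun g =>
    IsOddPrimary g ∧ Nat.card (fixedBy Ω g) ≠ 0 ∧ Nat.card (fixedBy Ω g) ≠ m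
  have h0 : oddFixWeight G Ω ≤ ∑ g : G, fixWeight (Nat.card Ω) 0 +
      ∑ g : G with P₁ g, w g + ∑ g : G with P₂ g, w g := by
    rw [oddFixWeight, Finset.sum_filter, Finset.sum_filter, Finset.sum_filter,
      ← Finset.sum_add_distrib, ← Finset.sum_add_distrib]
    refine Finset.sum_le_sum fun g _ => ?_
    by_cases hg : IsOddPrimary g
    · rw [if_pos hg]
      by_cases hg0 : Nat.card (fixedBy Ω g) = 0
      · have := congrArg (fixWeight (Nat.card Ω)) hg0
        omega
      by_cases hg1 : P₁ g
      · rw [if_pos hg1]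
        change w g ≤ _
        omega
      · have hg2 : P₂ g := ⟨hg, hg0, hg1⟩
        rw [if_pos hg2]
        exact Nat.le_add_left _ _
    · rw [if_neg hg]
      exact Nat.zero_le _
  refine h0.trans (Nat.add_le_add (Nat.add_le_add ?_ ?_) ?_)
  · rw [Finset.sum_const, smul_eq_mul, Finset.card_univ, Nat.card_eq_fintype_card (α := G)]
  · refine sum_weight_le P₁ (fun g t hg => ?_) x (fixWeight (Nat.card Ω)) M₁ (fun g hg => ?_)
    · exact (card_fixedBy_conj g t).trans hg
    · rw [show Nat.card (fixedBy Ω g) = m from hg]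
      exact hM₁
  · refine (sum_weight_le P₂ (fun g t hg => ?_) x (fixWeight (Nat.card Ω)) M₂
      fun g hg => hM₂ g hg.1 hg.2.1 hg.2.2).trans ?_
    · exact ⟨isOddPrimary_conj hg.1 t, by rw [card_fixedBy_conj]; exact hg.2⟩
    · gcongr
      exact Nat.card_le_card_of_injective _ Subtype.val_injective

end Weight

section Affine

variable {G Ω : Type*} [Group G] [AddCommGroup Ω] [MulAction G Ω]

/-- A point stabilizer in an affine group acts linearly. -/
abbrev stabilizerDistribMulAction
    (hadd : ∀ g ∈ stabilizer G (0 : Ω), ∀ a b : Ω, g • (a + b) = g • a + g • b) :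
    DistribMulAction (stabilizer G (0 : Ω)) Ω where
  smul_zero h := h.2
  smul_add h := hadd h h.2

variable [Finite Ω] [FaithfulSMul G Ω] [IsPretransitive G Ω]

theorem card_fixedBy_eq_zero_or_pow
    (hadd : ∀ g ∈ stabilizer G (0 : Ω), ∀ a b : Ω, g • (a + b) = g • a + g • b)
    {p n : ℕ} (hp : p.Prime) (hn : Nat.card Ω = p ^ n) {g : G}
    (hg : g ≠ 1) : Nat.card (fixedBy Ω g) = 0 ∨ ∃ j < n, Nat.card (fixedBy Ω g) = p ^ j := by
  by_cases h0 : Nat.card (fixedBy Ω g) = 0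
  · exact Or.inl h0
  obtain ⟨t, ht⟩ := exists_conj_mem_stabilizer (0 : Ω) h0
  let _ := stabilizerDistribMulAction hadd
  have h1 : (⟨t * g * t⁻¹, ht⟩ : stabilizer G (0 : Ω)) ≠ 1 := fun h =>
    hg (conj_eq_one_iff.mp (congrArg Subtype.val h))
  obtain ⟨j, hj, hc⟩ := exists_card_fixedBy_eq_pow_lt hp hn h1
  exact Or.inr ⟨j, hj, (card_fixedBy_conj g t).symm.trans hc⟩

theorem card_fixedBy_eq_zero_or_two_pow
    (hadd : ∀ g ∈ stabilizer G (0 : Ω), ∀ a b : Ω, g • (a + b) = g • a + g • b)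
    {n : ℕ} (hn : Nat.card Ω = 2 ^ n) {g : G}
    (hg : g ^ 2 ≠ 1) :
    Nat.card (fixedBy Ω g) = 0 ∨ ∃ j, j + 2 ≤ n ∧ Nat.card (fixedBy Ω g) = 2 ^ j := by
  by_cases h0 : Nat.card (fixedBy Ω g) = 0
  · exact Or.inl h0
  obtain ⟨t, ht⟩ := exists_conj_mem_stabilizer (0 : Ω) h0
  let _ := stabilizerDistribMulAction hadd
  have h1 : (⟨t * g * t⁻¹, ht⟩ : stabilizer G (0 : Ω)) ^ 2 ≠ 1 := fun h => by
    have h2 := congrArg Subtype.val h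
    simp only [Subgroup.coe_pow, conj_pow, Subgroup.coe_one] at h2
    exact hg (conj_eq_one_iff.mp h2)
  obtain ⟨j, hj, hc⟩ := exists_card_fixedBy_eq_two_pow hn h1
  exact Or.inr ⟨j, hj, (card_fixedBy_conj g t).symm.trans hc⟩

theorem card_le_card_pow_of_affine
    (hadd : ∀ g ∈ stabilizer G (0 : Ω), ∀ a b : Ω, g • (a + b) = g • a + g • b)
    [Finite G] {p n : ℕ} (hp : p.Prime)
    (hpW : ∀ a : Ω, p • a = 0) (hn : Nat.card Ω = p ^ n) : Nat.card G ≤ (p ^ n) ^ (n + 1) := by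
  let _ := stabilizerDistribMulAction hadd
  rw [card_eq_card_mul_card_stabilizer (0 : Ω), hn, pow_succ']
  exact Nat.mul_le_mul_left _ (card_le_card_pow hp hpW hn)

end Affine

theorem two_pow_bound {n : ℕ} (hn : 5 ≤ n) :
    (2 ^ (n + 2)) ^ (n + 3) * fixWeight (2 ^ (n + 2)) (2 ^ n) < 2 ^ (2 ^ (n + 2) + 2) := by
  have h : (n + 2) * (n + 3) < 2 * 2 ^ n + 2 := by
    induction n, hn using Nat.le_induction with
    | base => norm_num
    | succ n hn ih =>
      rw [pow_succ]
      nlinarith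
  have h4 : 2 ^ (n + 2) = 4 * 2 ^ n := by ring
  rw [fixWeight, ← pow_mul, ← pow_add]
  refine Nat.pow_lt_pow_right one_lt_two ?_
  omega

theorem three_pow_bound {n : ℕ} (hn : 2 ≤ n) :
    (3 ^ (n + 2)) ^ (n + 3) * fixWeight (3 ^ (n + 2)) (3 ^ (n + 1)) <
      2 ^ (3 ^ (n + 2) + 2) := by
  have h : 8 * ((n + 2) * (n + 3)) < 20 * 3 ^ n + 10 := by
    induction n, hn using Nat.le_induction with
    | base => norm_num
    | succ n hn ih =>
      rw [pow_succ]
      nlinarith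
  have h9 : 3 ^ (n + 2) = 9 * 3 ^ n := by ring
  have h3 : 3 ^ (n + 1) = 3 * 3 ^ n := by ring
  have hw : fixWeight (3 ^ (n + 2)) (3 ^ (n + 1)) = 2 ^ (5 * 3 ^ n) := by
    rw [fixWeight]
    congr 1
    omega
  rw [hw, ← pow_mul]
  refine lt_of_pow_lt_pow_left₀ 5 (by positivity) ?_
  calc (3 ^ ((n + 2) * (n + 3)) * 2 ^ (5 * 3 ^ n)) ^ 5
      = (3 ^ 5) ^ ((n + 2) * (n + 3)) * 2 ^ (25 * 3 ^ n) := by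
        rw [mul_pow, pow_right_comm, ← pow_mul 2]
        congr 2
        ring
    _ ≤ (2 ^ 8) ^ ((n + 2) * (n + 3)) * 2 ^ (25 * 3 ^ n) :=
        Nat.mul_le_mul_right _ (Nat.pow_le_pow_left (by norm_num) _)
    _ = 2 ^ (8 * ((n + 2) * (n + 3)) + 25 * 3 ^ n) := by rw [← pow_mul, pow_add]
    _ < 2 ^ ((3 ^ (n + 2) + 2) * 5) := Nat.pow_lt_pow_right one_lt_two (by omega)
    _ = _ := by rw [pow_mul]

set_option exponentiation.threshold 1000 in
theorem prime_pow_bound {p n : ℕ} (hp : 5 ≤ p) (hn : 1 ≤ n) (hN : 10 < p ^ n) :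
    (p ^ n) ^ (n + 1) * fixWeight (p ^ n) (p ^ n / 5) < 2 ^ (p ^ n + 2) := by
  have hstep : ∀ k, 1 ≤ k → p ^ (15 * (k * (k + 1))) < 2 ^ (8 * p ^ k + 30) →
      p ^ (15 * ((k + 1) * (k + 2))) < 2 ^ (8 * p ^ (k + 1) + 30) := by
    intro k hk ih
    have h5 : 5 ≤ p ^ k := hp.trans (Nat.le_self_pow (by omega) p)
    calc p ^ (15 * ((k + 1) * (k + 2))) ≤ p ^ (15 * (k * (k + 1)) * 3) :=
          Nat.pow_le_pow_right (by omega) (by nlinarith)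
      _ = (p ^ (15 * (k * (k + 1)))) ^ 3 := pow_mul ..
      _ < (2 ^ (8 * p ^ k + 30)) ^ 3 := Nat.pow_lt_pow_left ih (by norm_num)
      _ = 2 ^ ((8 * p ^ k + 30) * 3) := (pow_mul ..).symm
      _ ≤ 2 ^ (8 * p ^ (k + 1) + 30) := by
          refine Nat.pow_le_pow_right two_pos ?_
          rw [pow_succ]
          nlinarith
  have hbase : 11 ≤ p → p ^ 30 < 2 ^ (8 * p + 30) := by
    intro h11
    clear hstep hN hp
    induction p, h11 using Nat.le_induction with
    | base => norm_num
    | succ p hp ih =>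
      refine lt_of_mul_lt_mul_right ?_ (Nat.zero_le (11 ^ 30))
      calc (p + 1) ^ 30 * 11 ^ 30 = ((p + 1) * 11) ^ 30 := by rw [mul_pow]
        _ ≤ (12 * p) ^ 30 := Nat.pow_le_pow_left (by omega) 30
        _ = 12 ^ 30 * p ^ 30 := mul_pow ..
        _ < 12 ^ 30 * 2 ^ (8 * p + 30) := by gcongr
        _ ≤ (2 ^ 8 * 11 ^ 30) * 2 ^ (8 * p + 30) := by
            gcongr
            norm_num
        _ = 2 ^ (8 * (p + 1) + 30) * 11 ^ 30 := by
            rw [mul_add, add_right_comm, pow_add]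
            ring
  have hmain : p ^ (15 * (n * (n + 1))) < 2 ^ (8 * p ^ n + 30) := by
    by_cases h11 : 11 ≤ p
    · clear hN
      induction n, hn using Nat.le_induction with
      | base => simpa using hbase h11
      | succ k hk ih => exact hstep k hk ih
    · have h2 : 2 ≤ n := by
        by_contra h
        obtain rfl : n = 1 := by omega
        rw [pow_one] at hN
        omega
      clear hN hn
      induction n, h2 using Nat.le_induction with
      | base =>
        clear hbase hstep
        interval_cases p <;> norm_num
      | succ k hk ih => exact hstep k (by omega) ih
  refine lt_of_pow_lt_pow_left₀ 15 (by positivity) ?_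
  rw [fixWeight, ← pow_mul, mul_pow, ← pow_mul, ← pow_mul, mul_comm _ 15]
  calc p ^ (15 * (n * (n + 1))) * 2 ^ ((p ^ n / 5 + (p ^ n - p ^ n / 5) / 3) * 15)
      < 2 ^ (8 * p ^ n + 30) * 2 ^ ((p ^ n / 5 + (p ^ n - p ^ n / 5) / 3) * 15) := by
        gcongr
    _ ≤ (2 ^ (p ^ n + 2)) ^ 15 := by
        rw [← pow_mul, ← pow_add]
        refine Nat.pow_le_pow_right two_pos ?_
        omega

theorem IsOddPrimary.odd_orderOf {G : Type*} [Group G] {g : G} (hg : IsOddPrimary g) :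
    Odd (orderOf g) := by
  obtain ⟨-, r, k, hr, hr2, ho⟩ := hg
  exact ho ▸ (hr.odd_of_ne_two hr2).pow

theorem IsOddPrimary.sq_ne_one {G : Type*} [Group G] {g : G} (hg : IsOddPrimary g) :
    g ^ 2 ≠ 1 := fun h => by
  refine hg.1 (orderOf_eq_one_iff.mp ?_)
  exact Nat.eq_one_of_dvd_coprimes (Nat.coprime_two_right.mpr hg.odd_orderOf) dvd_rfl
    (orderOf_dvd_of_pow_eq_one h)

section Cases

variable {G Ω : Type*} [Group G] [AddCommGroup Ω] [MulAction G Ω]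
  [Finite Ω] [FaithfulSMul G Ω] [IsPretransitive G Ω]

theorem card_fixedBy_le_pow
    (hadd : ∀ g ∈ stabilizer G (0 : Ω), ∀ a b : Ω, g • (a + b) = g • a + g • b)
    {p n : ℕ} (hp : p.Prime) (hn : Nat.card Ω = p ^ (n + 1)) {g : G} (hg : g ≠ 1) :
    Nat.card (fixedBy Ω g) ≤ p ^ n := by
  obtain h | ⟨j, hj, h⟩ := card_fixedBy_eq_zero_or_pow hadd hp hn hg
  · exact h ▸ Nat.zero_le _
  · exact h ▸ Nat.pow_le_pow_right hp.pos (by omega)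

theorem card_fixedBy_le_two_pow
    (hadd : ∀ g ∈ stabilizer G (0 : Ω), ∀ a b : Ω, g • (a + b) = g • a + g • b)
    {n : ℕ} (hn : Nat.card Ω = 2 ^ (n + 2)) {g : G} (hg : IsOddPrimary g) :
    Nat.card (fixedBy Ω g) ≤ 2 ^ n := by
  obtain h | ⟨j, hj, h⟩ := card_fixedBy_eq_zero_or_two_pow hadd hn hg.sq_ne_one
  · exact h ▸ Nat.zero_le _
  · exact h ▸ Nat.pow_le_pow_right two_pos (by omega)

theorem oddFixWeight_lt_of_card_fixedBy_le [Fintype G]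
    (hadd : ∀ g ∈ stabilizer G (0 : Ω), ∀ a b : Ω, g • (a + b) = g • a + g • b)
    {p n m : ℕ} (hp : p.Prime) (hpW : ∀ a : Ω, p • a = 0) (hn : Nat.card Ω = p ^ n)
    (hm : m ≤ p ^ n) (hf : ∀ g : G, IsOddPrimary g → Nat.card (fixedBy Ω g) ≤ m)
    (h : (p ^ n) ^ (n + 1) * fixWeight (p ^ n) m < 2 ^ (p ^ n + 2)) :
    oddFixWeight G Ω < 2 ^ (Nat.card Ω + 2) := by
  rw [hn]
  refine lt_of_le_of_lt ?_ h
  rw [← hn] at hm ⊢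
  refine (oddFixWeight_le hm hf).trans (Nat.mul_le_mul_right _ ?_)
  rw [hn]
  exact card_le_card_pow_of_affine hadd hp hpW hn

theorem oddFixWeight_lt_of_card_eq_27 [Fintype G]
    (hadd : ∀ g ∈ stabilizer G (0 : Ω), ∀ a b : Ω, g • (a + b) = g • a + g • b)
    (hpW : ∀ a : Ω, 3 • a = 0) (hn : Nat.card Ω = 3 ^ 3) :
    oddFixWeight G Ω < 2 ^ (Nat.card Ω + 2) := by
  let _ := stabilizerDistribMulAction hadd
  have hH : Nat.card (stabilizer G (0 : Ω)) ≤ 11232 :=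
    (card_le_card_GL Nat.prime_three hpW hn).trans (by simp [Fin.prod_univ_three])
  have h9 : Nat.card {h : stabilizer G (0 : Ω) // Nat.card (fixedBy Ω h) = 9} ≤ 729 :=
    card_fixedBy_eq_le (n := 2) (d := 1) Nat.prime_three hpW hn
  have hM : ∀ g : G, IsOddPrimary g → Nat.card (fixedBy Ω g) ≠ 0 → Nat.card (fixedBy Ω g) ≠ 9 →
      fixWeight (Nat.card Ω) (Nat.card (fixedBy Ω g)) ≤ 683 * Nat.card (fixedBy Ω g) := by
    intro g hg h0 h9
    obtain h | ⟨j, hj, h⟩ := card_fixedBy_eq_zero_or_pow hadd Nat.prime_three hn hg.1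
    · exact absurd h h0
    rw [h, hn]
    interval_cases j
    · norm_num [fixWeight]
    · norm_num [fixWeight]
    · exact absurd h h9
  have h := oddFixWeight_le_add (0 : Ω) 9 (M₁ := 3641)
    (by rw [hn]; norm_num [fixWeight]) hM
  change oddFixWeight G Ω ≤ _ + _ * (_ *
    Nat.card {h : stabilizer G (0 : Ω) // Nat.card (fixedBy Ω h) = 9}) + _ at h
  rw [card_eq_card_mul_card_stabilizer (G := G) (0 : Ω), hn] at h
  generalize Nat.card (stabilizer G (0 : Ω)) = s at h hH
  generalize Nat.card {h : stabilizer G (0 : Ω) // Nat.card (fixedBy Ω h) = 9} = t at h h9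
  rw [hn]
  norm_num [fixWeight] at h hH h9 ⊢
  omega

theorem oddFixWeight_lt_of_card_eq_64 [Fintype G]
    (hadd : ∀ g ∈ stabilizer G (0 : Ω), ∀ a b : Ω, g • (a + b) = g • a + g • b)
    (hpW : ∀ a : Ω, 2 • a = 0) (hn : Nat.card Ω = 2 ^ 6) :
    oddFixWeight G Ω < 2 ^ (Nat.card Ω + 2) := by
  let _ := stabilizerDistribMulAction hadd
  have hH : Nat.card (stabilizer G (0 : Ω)) ≤ (2 ^ 6) ^ 6 :=
    card_le_card_pow Nat.prime_two hpW hn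
  have h16 : Nat.card {h : stabilizer G (0 : Ω) // Nat.card (fixedBy Ω h) = 16} ≤ 2 ^ 24 :=
    card_fixedBy_eq_le (n := 4) (d := 2) Nat.prime_two hpW hn
  have hM : ∀ g : G, IsOddPrimary g → Nat.card (fixedBy Ω g) ≠ 0 → Nat.card (fixedBy Ω g) ≠ 16 →
      fixWeight (Nat.card Ω) (Nat.card (fixedBy Ω g)) ≤ 2 ^ 23 * Nat.card (fixedBy Ω g) := by
    intro g hg h0 h16
    obtain h | ⟨j, hj, h⟩ := card_fixedBy_eq_zero_or_two_pow hadd hn hg.sq_ne_one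
    · exact absurd h h0
    have hj4 : j ≤ 4 := by omega
    rw [h, hn]
    interval_cases j
    · norm_num [fixWeight]
    · norm_num [fixWeight]
    · norm_num [fixWeight]
    · norm_num [fixWeight]
    · exact absurd h h16
  have h := oddFixWeight_le_add (0 : Ω) 16 (M₁ := 2 ^ 28)
    (by rw [hn]; norm_num [fixWeight]) hM
  change oddFixWeight G Ω ≤ _ + _ * (_ *
    Nat.card {h : stabilizer G (0 : Ω) // Nat.card (fixedBy Ω h) = 16}) + _ at h
  rw [card_eq_card_mul_card_stabilizer (G := G) (0 : Ω), hn] at h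
  generalize Nat.card (stabilizer G (0 : Ω)) = s at h hH
  generalize Nat.card {h : stabilizer G (0 : Ω) // Nat.card (fixedBy Ω h) = 16} = t at h h16
  rw [hn]
  norm_num [fixWeight] at h hH h16 ⊢
  omega

theorem oddFixWeight_lt_of_card_eq_32 [Fintype G]
    (hadd : ∀ g ∈ stabilizer G (0 : Ω), ∀ a b : Ω, g • (a + b) = g • a + g • b)
    (hn : Nat.card Ω = 2 ^ 5) (hH : Nat.card (stabilizer G (0 : Ω)) ≤ 930) :
    oddFixWeight G Ω < 2 ^ (Nat.card Ω + 2) := by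
  have h := oddFixWeight_le (G := G) (Ω := Ω) (m := 2 ^ 3) (by rw [hn]; norm_num)
    fun g hg => card_fixedBy_le_two_pow hadd hn hg
  rw [card_eq_card_mul_card_stabilizer (G := G) (0 : Ω), hn] at h
  generalize Nat.card (stabilizer G (0 : Ω)) = s at h hH
  rw [hn]
  norm_num [fixWeight] at h ⊢
  omega

theorem oddFixWeight_lt_of_card_eq_16 [Fintype G]
    (hadd : ∀ g ∈ stabilizer G (0 : Ω), ∀ a b : Ω, g • (a + b) = g • a + g • b)
    (hn : Nat.card Ω = 2 ^ 4)
    (hH : Nat.card {h : stabilizer G (0 : Ω) // IsOddPrimary h} < 256) :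
    oddFixWeight G Ω < 2 ^ (Nat.card Ω + 2) := by
  have hM : ∀ g : G, IsOddPrimary g →
      fixWeight (Nat.card Ω) (Nat.card (fixedBy Ω g)) ≤ 64 * Nat.card (fixedBy Ω g) := by
    intro g hg
    obtain h | ⟨j, hj, h⟩ := card_fixedBy_eq_zero_or_two_pow hadd hn hg.sq_ne_one
    · obtain ⟨h1, r, k, hr, hr2, ho⟩ := hg
      have : Fact r.Prime := ⟨hr⟩
      have hP : IsPGroup r (Subgroup.zpowers g) :=
        IsPGroup.of_card (n := k) (by rw [Nat.card_zpowers, ho])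
      have hr16 : ¬ r ∣ Nat.card Ω := by
        rw [hn]
        exact fun hd => hr2 ((Nat.prime_dvd_prime_iff_eq hr Nat.prime_two).mp
          (hr.dvd_of_dvd_pow hd))
      obtain ⟨y, hy⟩ := hP.nonempty_fixed_point_of_prime_not_dvd_card Ω hr16
      have : Nonempty (fixedBy Ω g) := ⟨⟨y, hy ⟨g, Subgroup.mem_zpowers g⟩⟩⟩
      exact absurd h Nat.card_pos.ne'
    have hj4 : j ≤ 2 := by omega
    rw [h, hn]
    interval_cases j <;> norm_num [fixWeight]
  have hinj : Nat.card {h : stabilizer G (0 : Ω) // IsOddPrimary (h : G)} ≤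
      Nat.card {h : stabilizer G (0 : Ω) // IsOddPrimary h} := by
    refine Nat.card_le_card_of_injective (fun h => ⟨h.1, ?_, ?_⟩) fun a b hab => ?_
    · exact fun h1 => h.2.1 (congrArg Subtype.val h1)
    · simpa only [Subgroup.orderOf_coe] using h.2.2
    · exact Subtype.ext (congrArg (fun z => z.1) hab)
  have h := oddFixWeight_le_of_forall_le (0 : Ω) hM
  rw [hn] at h ⊢
  norm_num at h ⊢
  omega

end Cases

section Irreducible

variable {W H : Type*} [AddCommGroup W] [Group H] [DistribMulAction H W]

theorem smul_fixedAddSubgroup (h a : H) :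
    h • fixedAddSubgroup W a = fixedAddSubgroup W (h * a * h⁻¹) := by
  ext w
  rw [AddSubgroup.mem_pointwise_smul_iff_inv_smul_mem, mem_fixedAddSubgroup,
    mem_fixedAddSubgroup, mul_smul, mul_smul, smul_eq_iff_eq_inv_smul h]

/-- The fixed space of `c` is invariant under every element commuting with `c`. -/
theorem smul_mem_fixedAddSubgroup {a c : H} (hac : a * c = c * a) {w : W}
    (hw : w ∈ fixedAddSubgroup W c) : a • w ∈ fixedAddSubgroup W c := by
  rw [mem_fixedAddSubgroup] at *
  rw [smul_smul, ← hac, mul_smul, hw]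

/-- In a faithful irreducible representation, a normal subgroup fixing a nonzero vector
is trivial. -/
theorem eq_zero_of_forall_mem_smul_eq [FaithfulSMul H W]
    (hirr : ∀ U : AddSubgroup W, (∀ h : H, ∀ a ∈ U, h • a ∈ U) → U = ⊥ ∨ U = ⊤)
    {A : Subgroup H} (hA : A.Normal) (hA1 : A ≠ ⊥) {w : W} (hw : ∀ a ∈ A, a • w = w) :
    w = 0 := by
  let U : AddSubgroup W :=
    { carrier := {w | ∀ a ∈ A, a • w = w}
      add_mem' := fun hu hv a ha => by rw [smul_add, hu a ha, hv a ha]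
      zero_mem' := fun a _ => smul_zero a
      neg_mem' := fun hu a ha => by rw [smul_neg, hu a ha] }
  have hU : ∀ h : H, ∀ u ∈ U, h • u ∈ U := by
    intro h u hu a ha
    have h1 := hu _ (hA.conj_mem a ha h⁻¹)
    rw [inv_inv, mul_smul, mul_smul, inv_smul_eq_iff] at h1
    exact h1
  obtain h | h := hirr U hU
  · exact (AddSubgroup.mem_bot).mp (h ▸ (show w ∈ U from hw))
  · refine absurd ?_ hA1
    rw [Subgroup.eq_bot_iff_forall]
    intro a ha
    refine FaithfulSMul.eq_of_smul_eq_smul fun u : W => ?_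
    rw [one_smul]
    exact (show u ∈ U from h ▸ AddSubgroup.mem_top u) a ha

theorem isPGroup_of_pow_eq_one {r : ℕ} {A : Subgroup H} (hA : ∀ a ∈ A, a ^ r = 1) :
    IsPGroup r A := fun a => ⟨1, Subtype.ext (by simpa using hA a a.2)⟩

/-- An additive subgroup on which an `r`-group acts without nonzero fixed points has order
congruent to one modulo `r`. -/
theorem card_modEq_one [Finite W] {r : ℕ} (hr : r.Prime) {A : Subgroup H} (hA : IsPGroup r A)
    (hfix : ∀ w : W, (∀ a ∈ A, a • w = w) → w = 0) {U : AddSubgroup W}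
    (hU : ∀ a ∈ A, ∀ u ∈ U, a • u ∈ U) : Nat.card U ≡ 1 [MOD r] := by
  have : Fact r.Prime := ⟨hr⟩
  let _ : MulAction A U :=
    { smul := fun a u => ⟨a.1 • u.1, hU a.1 a.2 u.1 u.2⟩
      one_smul := fun u => Subtype.ext (one_smul H u.1)
      mul_smul := fun a b u => Subtype.ext (mul_smul a.1 b.1 u.1) }
  have h1 := hA.card_modEq_card_fixedPoints U
  have h2 : fixedPoints A U = {0} := by
    ext u
    rw [Set.mem_singleton_iff]
    constructor
    · intro hu
      exact Subtype.ext (hfix u.1 fun a ha => congrArg Subtype.val (hu ⟨a, ha⟩))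
    · rintro rfl a
      exact Subtype.ext (smul_zero a.1)
  rw [h2] at h1
  simpa using h1

theorem card_fixedAddSubgroup_modEq_one [Finite W] {r : ℕ} (hr : r.Prime) {a c : H}
    (har : a ^ r = 1) (ha : fixedAddSubgroup W a = ⊥) (hac : a * c = c * a) :
    Nat.card (fixedAddSubgroup W c) ≡ 1 [MOD r] := by
  refine card_modEq_one hr (A := Subgroup.zpowers a) (isPGroup_of_pow_eq_one ?_) ?_ ?_
  · rintro _ ⟨k, rfl⟩
    simp only
    rw [← zpow_natCast, zpow_comm, zpow_natCast, har, one_zpow]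
  · intro w hw
    exact (AddSubgroup.mem_bot).mp (ha ▸ mem_fixedAddSubgroup.mpr (hw a (Subgroup.mem_zpowers a)))
  · rintro _ ⟨k, rfl⟩ u hu
    exact smul_mem_fixedAddSubgroup ((show Commute a c from hac).zpow_left k) hu

theorem card_fixedAddSubgroup_modEq_one_of_mem [Finite W] {r : ℕ} (hr : r.Prime) {A : Subgroup H}
    (hAc : ∀ a ∈ A, ∀ b ∈ A, a * b = b * a) (hAr : ∀ a ∈ A, a ^ r = 1)
    (hfix : ∀ w : W, (∀ a ∈ A, a • w = w) → w = 0) {a : H} (ha : a ∈ A) :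
    Nat.card (fixedAddSubgroup W a) ≡ 1 [MOD r] :=
  card_modEq_one hr (isPGroup_of_pow_eq_one hAr) hfix
    fun b hb _ hu => smul_mem_fixedAddSubgroup (hAc b hb a ha) hu

/-- If the orders of invariant subgroups force them to be trivial, then point stabilizers in
centralizers are trivial and the linear group is small. -/
theorem card_le_of_semiregular [Finite W] [Nontrivial W] [FaithfulSMul H W] {r : ℕ}
    (hr : r.Prime) {A : Subgroup H} (hAn : A.Normal) (hA1 : A ≠ ⊥)
    (hAc : ∀ a ∈ A, ∀ b ∈ A, a * b = b * a) (hAr : ∀ a ∈ A, a ^ r = 1)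
    (hfix : ∀ w : W, (∀ a ∈ A, a • w = w) → w = 0)
    (hS : ∀ U : AddSubgroup W, Nat.card U ≡ 1 [MOD r] → U = ⊥ ∨ U = ⊤) :
    Nat.card H ≤ (Nat.card W - 2) * (Nat.card W - 1) := by
  obtain ⟨a, ha, ha1⟩ := A.bot_or_exists_ne_one.resolve_left hA1
  obtain ⟨v, hv⟩ := exists_ne (0 : W)
  have hFa : ∀ b ∈ A, b ≠ 1 → fixedAddSubgroup W b = ⊥ := fun b hb hb1 =>
    (hS _ (card_fixedAddSubgroup_modEq_one_of_mem hr hAc hAr hfix hb)).resolve_right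
      fun h => hb1 (eq_one_of_fixedAddSubgroup_eq_top h)
  have hfree : ∀ c : H, a * c = c * a → c • v = v → c = 1 := by
    intro c hac hcv
    obtain h | h := hS _ (card_fixedAddSubgroup_modEq_one hr (hAr a ha) (hFa a ha ha1) hac)
    · exact absurd ((AddSubgroup.mem_bot).mp (h ▸ mem_fixedAddSubgroup.mpr hcv)) hv
    · exact eq_one_of_fixedAddSubgroup_eq_top h
  have hW : Nat.card {w : W // w ≠ 0} = Nat.card W - 1 := by
    have := Fintype.ofFinite W
    classical
    rw [Nat.card_eq_fintype_card, Nat.card_eq_fintype_card, Fintype.card_subtype_compl,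
      Fintype.card_subtype_eq]
  have hAinj : Function.Injective fun c : A => c.1 • v := fun b c hbc => by
    refine Subtype.ext (inv_mul_eq_one.mp (hfree (b.1⁻¹ * c.1) ?_ ?_))
    · exact hAc a ha _ (A.mul_mem (A.inv_mem b.2) c.2)
    · rw [mul_smul, inv_smul_eq_iff]
      exact hbc.symm
  have : Finite A := Finite.of_injective _ hAinj
  have hA : Nat.card {b : A // b ≠ 1} ≤ Nat.card W - 2 := by
    have h1 : Nat.card {b : A // b ≠ 1} = Nat.card A - 1 := by
      have := Fintype.ofFinite A
      classical
      rw [Nat.card_eq_fintype_card, Nat.card_eq_fintype_card, Fintype.card_subtype_compl,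
        Fintype.card_subtype_eq]
    have h2 : Nat.card A ≤ Nat.card {w : W // w ≠ 0} :=
      Nat.card_le_card_of_injective
        (fun c : A => ⟨c.1 • v, (smul_ne_zero_iff_ne c.1).mpr hv⟩)
        fun b c hbc => hAinj (congrArg Subtype.val hbc)
    omega
  let F : H → {b : A // b ≠ 1} × {w : W // w ≠ 0} := fun h =>
    (⟨⟨h * a * h⁻¹, hAn.conj_mem a ha h⟩, fun hh => ha1 (conj_eq_one_iff.mp
      (congrArg Subtype.val hh))⟩, ⟨h • v, (smul_ne_zero_iff_ne h).mpr hv⟩)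
  have hF : Function.Injective F := by
    intro h k hhk
    have h1 : h * a * h⁻¹ = k * a * k⁻¹ := congrArg (fun z => (z.1.1 : H)) hhk
    have h2 : h • v = k • v := congrArg (fun z => z.2.1) hhk
    refine (inv_mul_eq_one.mp (hfree (k⁻¹ * h) ?_ ?_)).symm
    · calc a * (k⁻¹ * h) = k⁻¹ * (k * a * k⁻¹) * h := by group
        _ = k⁻¹ * h * a := by rw [← h1]; group
    · rw [mul_smul, h2, inv_smul_smul]
  calc Nat.card H ≤ _ := Nat.card_le_card_of_injective F hF
    _ ≤ _ := by
      rw [Nat.card_prod, hW]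
      exact Nat.mul_le_mul_right _ hA

end Irreducible

theorem mem_zpowers_sq_of_odd {H : Type*} [Group H] {h : H} (hh : Odd (orderOf h)) :
    h ∈ Subgroup.zpowers (h ^ 2) := by
  rw [mem_zpowers_pow_iff]
  exact Nat.coprime_two_left.mpr hh

section Sixteen

variable {W H : Type*} [AddCommGroup W] [Group H] [DistribMulAction H W]

theorem card_of_fixedPointFree [Finite W] [Finite H] {r : ℕ}
    (hr : r.Prime) (hrW : Nat.card W = r * 5 + 1) {A : Subgroup H}
    (hA1 : A ≠ ⊥) (hAr : ∀ a ∈ A, a ^ r = 1) (hr5 : r ≠ 5)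
    (hfree : ∀ a ∈ A, a ≠ 1 → fixedAddSubgroup W a = ⊥) : Nat.card A = r := by
  classical
  have := Fintype.ofFinite H
  have := Fintype.ofFinite W
  have : Fact r.Prime := ⟨hr⟩
  have h1 := MulAction.sum_card_fixedBy_eq_card_orbits_mul_card_group A W
  have hfix : ∀ a : A, a ≠ 1 → Fintype.card (fixedBy W a) = 1 := by
    intro a ha
    rw [← Nat.card_eq_fintype_card]
    change Nat.card (fixedAddSubgroup W a.1) = 1
    rw [hfree a.1 a.2 fun h => ha (Subtype.ext h), AddSubgroup.card_bot]
  have hone : Fintype.card (fixedBy W (1 : A)) = Nat.card W := by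
    rw [← Nat.card_eq_fintype_card, fixedBy_one_eq_univ, Nat.card_univ]
  rw [← Finset.add_sum_erase _ _ (Finset.mem_univ 1), hone, Finset.sum_congr rfl
    fun a ha => hfix a (Finset.ne_of_mem_erase ha), Finset.sum_const, smul_eq_mul, mul_one,
    Finset.card_erase_of_mem (Finset.mem_univ _), Finset.card_univ, hrW,
    ← Nat.card_eq_fintype_card (α := A)] at h1
  have hpos : 0 < Nat.card A := Nat.card_pos
  have hdvd : Nat.card A ∣ r * 5 := by
    have h2 : Nat.card A ∣ r * 5 + Nat.card A := ⟨_, by rw [mul_comm (Nat.card A), ← h1]; omega⟩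
    exact (Nat.dvd_add_left dvd_rfl).mp h2
  obtain ⟨k, hk⟩ := IsPGroup.iff_card.mp (isPGroup_of_pow_eq_one hAr)
  have hk0 : k ≠ 0 := by
    rintro rfl
    exact hA1 (Subgroup.card_eq_one.mp hk)
  obtain ⟨m, rfl⟩ := Nat.exists_eq_succ_of_ne_zero hk0
  rw [hk, pow_succ', Nat.mul_dvd_mul_iff_left hr.pos] at hdvd
  rw [hk]
  have hco : Nat.Coprime (r ^ m) 5 :=
    Nat.Coprime.pow_left _ ((Nat.coprime_primes hr Nat.prime_five).mpr hr5)
  rw [pow_succ, Nat.Coprime.eq_one_of_dvd hco hdvd, one_mul]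

/-- An element of odd order normalizing a subgroup of order three centralizes it. -/
theorem commute_of_odd_of_card_eq_three {H : Type*} [Group H] {A : Subgroup H}
    (hAn : A.Normal) (hA : Nat.card A = 3) {a h : H} (ha : a ∈ A) (hh : Odd (orderOf h)) :
    a * h = h * a := by
  classical
  by_cases ha1 : a = 1
  · rw [ha1, one_mul, mul_one]
  have : Finite A := Nat.finite_of_card_ne_zero (by omega)
  have hz : Subgroup.zpowers (⟨a, ha⟩ : A) = ⊤ := by
    have : Fact (Nat.card A).Prime := ⟨hA ▸ Nat.prime_three⟩
    exact zpowers_eq_top_of_prime_card rfl fun h => ha1 (congrArg Subtype.val h)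
  have ha3 : a ^ 3 = 1 := by
    have := pow_card_eq_one' (x := (⟨a, ha⟩ : A))
    rw [hA] at this
    exact congrArg Subtype.val this
  have hmem : ∃ i < 3, a ^ i = h * a * h⁻¹ := by
    have h1 : (⟨h * a * h⁻¹, hAn.conj_mem a ha h⟩ : A) ∈ Subgroup.zpowers (⟨a, ha⟩ : A) :=
      hz ▸ Subgroup.mem_top _
    rw [mem_zpowers_iff_mem_range_orderOf, Finset.mem_image] at h1
    obtain ⟨i, hi, hia⟩ := h1
    refine ⟨i, ?_, congrArg Subtype.val hia⟩
    have := orderOf_le_card (x := (⟨a, ha⟩ : A))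
    rw [Finset.mem_range] at hi
    omega
  have hsq : h ^ 2 ∈ Subgroup.centralizer {a} := by
    rw [Subgroup.mem_centralizer_singleton_iff]
    obtain ⟨i, hi, hia⟩ := hmem
    have h2 : h * a = a ^ i * h := by rw [hia]; group
    have h3 : h ^ 2 * a = a ^ (i * i) * h ^ 2 := by
      have h4 : ∀ j, h * a ^ j = a ^ (i * j) * h := by
        intro j
        induction j with
        | zero => simp
        | succ j ih => rw [pow_succ, ← mul_assoc, ih, mul_assoc, h2, ← mul_assoc, ← pow_add]; rfl
      rw [pow_two, mul_assoc, h2, ← mul_assoc, h4, mul_assoc]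
    rw [h3]
    interval_cases i
    · exact absurd (conj_eq_one_iff.mp (by rw [← hia, pow_zero])) ha1
    · simp
    · rw [show 2 * 2 = 3 + 1 from rfl, pow_succ, ha3, one_mul]
  have := (Subgroup.zpowers_le.mpr hsq) (mem_zpowers_sq_of_odd hh)
  rw [Subgroup.mem_centralizer_singleton_iff] at this
  exact this.symm

theorem card_odd_lt_of_fixedPointFree [Finite W] [Finite H] [FaithfulSMul H W]
    (hW : Nat.card W = 2 ^ 4) {A : Subgroup H} (hAn : A.Normal) (hA1 : A ≠ ⊥)
    (hAr : ∀ a ∈ A, a ^ 3 = 1)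
    (hfree : ∀ a ∈ A, a ≠ 1 → fixedAddSubgroup W a = ⊥) :
    Nat.card {h : H // Odd (orderOf h)} < 256 := by
  classical
  have hA := card_of_fixedPointFree Nat.prime_three hW hA1 hAr (by norm_num) hfree
  obtain ⟨a, ha, ha1⟩ := A.bot_or_exists_ne_one.resolve_left hA1
  have hFa := hfree a ha ha1
  have hnt : Nontrivial W := Finite.one_lt_card_iff_nontrivial.mp (by rw [hW]; norm_num)
  obtain ⟨v, hv⟩ := exists_ne (0 : W)
  have hFa' : ∀ w : W, a • w = w → w = 0 := fun w hw =>
    AddSubgroup.mem_bot.mp (hFa ▸ mem_fixedAddSubgroup.mpr hw)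
  let T : Finset W := {0, v, a • v, a • a • v}
  have hT : T.card ≤ 4 := Finset.card_le_four
  have hW' : Nat.card {w : W // w ≠ 0} = 15 := by
    have := Fintype.ofFinite W
    rw [Nat.card_eq_fintype_card] at hW
    rw [Nat.card_eq_fintype_card, Fintype.card_subtype_compl, Fintype.card_subtype_eq, hW]
    rfl
  obtain ⟨w, hw⟩ : ∃ w, w ∉ T := by
    by_contra! h
    have := Fintype.ofFinite W
    have h1 := Finset.card_le_card (fun w _ => h w : Finset.univ ⊆ T)
    rw [Finset.card_univ, ← Nat.card_eq_fintype_card, hW] at h1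
    omega
  have hav : a • v ≠ v := fun h => hv (hFa' v h)
  have haav : a • a • v ≠ a • v := fun h => hav (smul_left_cancel a h)
  have haav' : a • a • v ≠ v := fun h => hav (by
    have h3 := congrArg (a • ·) h
    rw [← h3, smul_smul, smul_smul, ← pow_three', hAr a ha, one_smul])
  have hav0 : a • v ≠ 0 := (smul_ne_zero_iff_ne a).mpr hv
  have haav0 : a • a • v ≠ 0 := (smul_ne_zero_iff_ne a).mpr hav0
  have hT4 : T.card = 4 := by
    rw [Finset.card_insert_of_notMem, Finset.card_insert_of_notMem,
      Finset.card_insert_of_notMem, Finset.card_singleton]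
    · simpa using haav.symm
    · simpa using ⟨hav.symm, haav'.symm⟩
    · simpa using ⟨hv.symm, hav0.symm, haav0.symm⟩
  have hkey : ∀ c : H, a * c = c * a → c • v = v → c • w = w → c = 1 := by
    intro c hac hcv hcw
    have h1 := card_fixedAddSubgroup_modEq_one Nat.prime_three (hAr a ha) hFa hac
    obtain ⟨j, hj, hc⟩ := exists_card_fixedBy_eq_pow Nat.prime_two hW c
    rw [card_fixedBy_eq] at hc
    have hsub : (↑(insert w T) : Set W) ⊆ fixedAddSubgroup W c := by
      have hca := smul_mem_fixedAddSubgroup hac (mem_fixedAddSubgroup.mpr hcv)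
      simp only [T, Finset.coe_insert, Finset.coe_singleton, Set.insert_subset_iff,
        Set.singleton_subset_iff]
      exact ⟨hcw, AddSubgroup.zero_mem _, hcv, hca, smul_mem_fixedAddSubgroup hac hca⟩
    have h5 := Set.ncard_le_ncard hsub
    rw [Set.ncard_coe_finset, Finset.card_insert_of_notMem hw, hT4] at h5
    change _ ≤ Nat.card (fixedAddSubgroup W c) at h5
    rw [hc] at h1 h5
    refine eq_one_of_fixedAddSubgroup_eq_top (W := W) ?_
    rw [← AddSubgroup.card_eq_iff_eq_top, hc, hW]
    interval_cases j
    · omega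
    · omega
    · omega
    · exact absurd h1 (by decide)
    · rfl
  let F : {h : H // Odd (orderOf h)} → {w : W // w ≠ 0} × W := fun h =>
    (⟨h.1 • v, (smul_ne_zero_iff_ne h.1).mpr hv⟩, h.1 • w)
  have hF : Function.Injective F := by
    intro h k hhk
    have h1 : h.1 • v = k.1 • v := congrArg (fun z => z.1.1) hhk
    have h2 : h.1 • w = k.1 • w := congrArg (fun z => z.2) hhk
    refine Subtype.ext (inv_mul_eq_one.mp (hkey (k.1⁻¹ * h.1) ?_ ?_ ?_)).symm
    · have hh : Commute a h.1 := commute_of_odd_of_card_eq_three hAn hA ha h.2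
      have hk : Commute a k.1 := commute_of_odd_of_card_eq_three hAn hA ha k.2
      exact hk.inv_right.mul_right hh
    · rw [mul_smul, h1, inv_smul_smul]
    · rw [mul_smul, h2, inv_smul_smul]
  refine (Nat.card_le_card_of_injective F hF).trans_lt ?_
  rw [Nat.card_prod, hW', hW]
  norm_num

theorem sup_eq_top_of_card [Finite W] {U U' : AddSubgroup W} (hd : U ⊓ U' = ⊥)
    (hc : Nat.card U * Nat.card U' = Nat.card W) : U ⊔ U' = ⊤ := by
  rw [eq_top_iff]
  intro w _
  have hinj : Function.Injective fun z : U × U' => (z.1 + z.2 : W) :=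
    AddSubgroup.add_injective_of_disjoint (disjoint_iff.mpr hd)
  obtain ⟨z, rfl⟩ := ((Nat.bijective_iff_injective_and_card _).mpr
    ⟨hinj, (Nat.card_prod U U').trans hc⟩).surjective w
  exact AddSubgroup.add_mem_sup z.1.2 z.2.2

theorem le_of_card_eq_four {U V : AddSubgroup W} (hU : Nat.card U = 4) {u₁ u₂ : W}
    (hu₁ : u₁ ∈ U) (hu₂ : u₂ ∈ U) (h₁ : u₁ ≠ 0) (h₂ : u₂ ≠ 0) (h₁₂ : u₁ ≠ u₂)
    (hv₁ : u₁ ∈ V) (hv₂ : u₂ ∈ V) : U ≤ V := by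
  classical
  have : Finite U := Nat.finite_of_card_ne_zero (by omega)
  have hle : Nat.card (U ⊓ V : AddSubgroup W) ∣ Nat.card U :=
    AddSubgroup.card_dvd_of_le inf_le_left
  have : Finite (U ⊓ V : AddSubgroup W) :=
    Nat.finite_of_card_ne_zero (ne_zero_of_dvd_ne_zero (by omega) hle)
  have hsub : ((({0, u₁, u₂} : Finset W)) : Set W) ⊆ (U ⊓ V : AddSubgroup W) := by
    simp only [Finset.coe_insert, Finset.coe_singleton, Set.insert_subset_iff,
      Set.singleton_subset_iff]
    exact ⟨AddSubgroup.zero_mem _, ⟨hu₁, hv₁⟩, ⟨hu₂, hv₂⟩⟩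
  have h3 := Set.ncard_le_ncard hsub (Set.toFinite _)
  rw [Set.ncard_coe_finset, Finset.card_insert_of_notMem (by simpa using ⟨h₁.symm, h₂.symm⟩),
    Finset.card_insert_of_notMem (by simpa using h₁₂), Finset.card_singleton] at h3
  change _ ≤ Nat.card (U ⊓ V : AddSubgroup W) at h3
  rw [hU] at hle
  have h4 : Nat.card (U ⊓ V : AddSubgroup W) = 4 := by
    have := Nat.le_of_dvd (by norm_num) hle
    interval_cases h : Nat.card (U ⊓ V : AddSubgroup W)
    · omega
    · rfl
  exact inf_eq_left.mp (AddSubgroup.eq_of_le_of_card_ge inf_le_left (by omega))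

theorem exists_pair_of_card_eq_four {U : AddSubgroup W} (hU : Nat.card U = 4) :
    ∃ u₁ ∈ U, ∃ u₂ ∈ U, u₁ ≠ 0 ∧ u₂ ≠ 0 ∧ u₁ ≠ u₂ := by
  have : Finite U := Nat.finite_of_card_ne_zero (by omega)
  have := Fintype.ofFinite U
  rw [Nat.card_eq_fintype_card] at hU
  classical
  have h1 : 1 < (Finset.univ.erase (0 : U)).card := by
    rw [Finset.card_erase_of_mem (Finset.mem_univ _), Finset.card_univ, hU]
    norm_num
  obtain ⟨a, ha, b, hb, hab⟩ := Finset.one_lt_card.mp h1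
  exact ⟨a, a.2, b, b.2, fun h => Finset.ne_of_mem_erase ha (Subtype.ext h),
    fun h => Finset.ne_of_mem_erase hb (Subtype.ext h), fun h => hab (Subtype.ext h)⟩

/-- The elements preserving both summands of a decomposition into two planes are few. -/
theorem card_lt_of_forall_smul_mem [Finite W] [FaithfulSMul H W] (hW : Nat.card W = 2 ^ 4)
    {U U' : AddSubgroup W} (hU : Nat.card U = 4) (hU' : Nat.card U' = 4) (hd : U ⊓ U' = ⊥)
    {P : H → Prop} (hP : ∀ h, P h → ∀ u ∈ U, h • u ∈ U) (hP' : ∀ h, P h → ∀ u ∈ U', h • u ∈ U') :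
    Nat.card {h : H // P h} < 256 := by
  obtain ⟨u₁, hu₁, u₂, hu₂, h₁, h₂, h₁₂⟩ := exists_pair_of_card_eq_four hU
  obtain ⟨v₁, hv₁, v₂, hv₂, k₁, k₂, k₁₂⟩ := exists_pair_of_card_eq_four hU'
  have hc : Nat.card {u : U // u ≠ 0} = 3 := by
    have := Fintype.ofFinite U
    classical
    rw [Nat.card_eq_fintype_card] at hU
    rw [Nat.card_eq_fintype_card, Fintype.card_subtype_compl, Fintype.card_subtype_eq, hU]
  let F : {h : H // P h} → {u : U // u ≠ 0} × U × U' × U' := fun h =>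
    (⟨⟨h.1 • u₁, hP h.1 h.2 u₁ hu₁⟩, fun hh => h₁ ((smul_eq_zero_iff_eq h.1).mp
      (congrArg Subtype.val hh))⟩, ⟨h.1 • u₂, hP h.1 h.2 u₂ hu₂⟩,
      ⟨h.1 • v₁, hP' h.1 h.2 v₁ hv₁⟩, ⟨h.1 • v₂, hP' h.1 h.2 v₂ hv₂⟩)
  have hF : Function.Injective F := by
    intro h k hhk
    have hm : ∀ w : W, h.1 • w = k.1 • w → w ∈ fixedAddSubgroup W (k.1⁻¹ * h.1) := by
      intro w hw
      rw [mem_fixedAddSubgroup, mul_smul, hw, inv_smul_smul]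
    have hUF := le_of_card_eq_four hU hu₁ hu₂ h₁ h₂ h₁₂
      (hm _ (congrArg (fun z => z.1.1.1) hhk)) (hm _ (congrArg (fun z => z.2.1.1) hhk))
    have hUF' := le_of_card_eq_four hU' hv₁ hv₂ k₁ k₂ k₁₂
      (hm _ (congrArg (fun z => z.2.2.1.1) hhk)) (hm _ (congrArg (fun z => z.2.2.2.1) hhk))
    have htop := sup_eq_top_of_card hd (by rw [hU, hU', hW]; rfl)
    have hone := eq_one_of_fixedAddSubgroup_eq_top (top_le_iff.mp (htop ▸ sup_le hUF hUF'))
    exact Subtype.ext (inv_mul_eq_one.mp hone).symm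
  refine (Nat.card_le_card_of_injective F hF).trans_lt ?_
  rw [Nat.card_prod, Nat.card_prod, Nat.card_prod, hc, hU, hU']
  norm_num

theorem mem_of_odd_of_sq_mem {S : Subgroup H} {h : H} (hh : Odd (orderOf h)) (hS : h ^ 2 ∈ S) :
    h ∈ S :=
  (Subgroup.zpowers_le.mpr hS) (mem_zpowers_sq_of_odd hh)

theorem card_odd_lt_of_fixedAddSubgroup_ne_bot [Finite W] [FaithfulSMul H W]
    (hirr : ∀ U : AddSubgroup W, (∀ h : H, ∀ a ∈ U, h • a ∈ U) → U = ⊥ ∨ U = ⊤)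
    (hW : Nat.card W = 2 ^ 4) {A : Subgroup H} (hAn : A.Normal)
    (hAc : ∀ a ∈ A, ∀ b ∈ A, a * b = b * a) (hAr : ∀ a ∈ A, a ^ 3 = 1)
    (hfix : ∀ w : W, (∀ a ∈ A, a • w = w) → w = 0)
    {a : H} (ha : a ∈ A) (ha1 : a ≠ 1) (hFa : fixedAddSubgroup W a ≠ ⊥) :
    Nat.card {h : H // Odd (orderOf h)} < 256 := by
  have hmod : ∀ U : AddSubgroup W, (∀ b ∈ A, ∀ u ∈ U, b • u ∈ U) → U ≠ ⊥ → U ≠ ⊤ →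
      Nat.card U = 4 := by
    intro U hU hbot htop
    have h1 := card_modEq_one Nat.prime_three (isPGroup_of_pow_eq_one hAr) hfix hU
    obtain ⟨j, hj, hc⟩ := (Nat.dvd_prime_pow Nat.prime_two).mp
      (hW ▸ AddSubgroup.card_addSubgroup_dvd_card U)
    rw [hc] at h1 ⊢
    interval_cases j
    · exact absurd (AddSubgroup.card_eq_one.mp hc) hbot
    · exact absurd h1 (by decide)
    · rfl
    · exact absurd h1 (by decide)
    · exact absurd ((AddSubgroup.card_eq_iff_eq_top _).mp (hc.trans hW.symm)) htop
  have hinv : ∀ c ∈ A, ∀ b ∈ A, ∀ u ∈ fixedAddSubgroup W c, b • u ∈ fixedAddSubgroup W c :=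
    fun c hc b hb _ hu => smul_mem_fixedAddSubgroup (hAc b hb c hc) hu
  have hconj : ∀ h : H, h * a * h⁻¹ ∈ A := fun h => hAn.conj_mem a ha h
  have hcard : ∀ h : H, Nat.card (fixedAddSubgroup W (h * a * h⁻¹)) = 4 := by
    intro h
    have hne : fixedAddSubgroup W (h * a * h⁻¹) ≠ ⊥ := by
      rw [← smul_fixedAddSubgroup]
      intro h1
      refine hFa ((AddSubgroup.eq_bot_iff_forall _).mpr fun u hu => ?_)
      have h2 := AddSubgroup.smul_mem_pointwise_smul u h _ hu
      rw [h1, AddSubgroup.mem_bot] at h2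
      exact (smul_eq_zero_iff_eq h).mp h2
    refine hmod _ (hinv _ (hconj h)) hne fun h1 => ?_
    exact ha1 (conj_eq_one_iff.mp (eq_one_of_fixedAddSubgroup_eq_top h1))
  have hdisj : ∀ U V : AddSubgroup W, (∀ b ∈ A, ∀ u ∈ U, b • u ∈ U) →
      (∀ b ∈ A, ∀ u ∈ V, b • u ∈ V) → Nat.card U = 4 → Nat.card V = 4 → U ≠ V →
      U ⊓ V = ⊥ := by
    intro U V hU hV hcU hcV hUV
    by_contra hne
    have h1 : Nat.card (U ⊓ V : AddSubgroup W) = 4 := by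
      refine hmod _ (fun b hb u hu => ⟨hU b hb u hu.1, hV b hb u hu.2⟩) hne fun htop => ?_
      have h2 := AddSubgroup.card_dvd_of_le (inf_le_left : U ⊓ V ≤ U)
      rw [htop, AddSubgroup.card_top, hW, hcU] at h2
      exact absurd h2 (by decide)
    refine hUV ?_
    rw [← AddSubgroup.eq_of_le_of_card_ge (inf_le_left : U ⊓ V ≤ U) (by omega)]
    exact AddSubgroup.eq_of_le_of_card_ge inf_le_right (by omega)
  obtain ⟨k, hk⟩ : ∃ k : H, k • fixedAddSubgroup W a ≠ fixedAddSubgroup W a := by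
    by_contra! hall
    obtain h | h := hirr (fixedAddSubgroup W a) fun h u hu =>
      (hall h).le (AddSubgroup.smul_mem_pointwise_smul u h _ hu)
    · exact hFa h
    · exact ha1 (eq_one_of_fixedAddSubgroup_eq_top h)
  set U := fixedAddSubgroup W a with hUdef
  set U' := k • U with hU'def
  have hU' : U' = fixedAddSubgroup W (k * a * k⁻¹) := smul_fixedAddSubgroup k a
  have hcU : Nat.card U = 4 := by simpa using hcard 1
  have hcU' : Nat.card U' = 4 := by rw [hU']; exact hcard k
  have hUinv := hinv a ha
  have hUinv' : ∀ b ∈ A, ∀ u ∈ U', b • u ∈ U' := by rw [hU']; exact hinv _ (hconj k)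
  have hd : U ⊓ U' = ⊥ := hdisj U U' hUinv hUinv' hcU hcU' hk.symm
  have htop : U ⊔ U' = ⊤ := sup_eq_top_of_card hd (by rw [hcU, hcU', hW]; rfl)
  have htwo : ∀ h : H, h • U = U ∨ h • U = U' := by
    intro h
    by_contra! hne
    have hV : h • U = fixedAddSubgroup W (h * a * h⁻¹) := smul_fixedAddSubgroup h a
    have hcV : Nat.card (h • U : AddSubgroup W) = 4 := by rw [hV]; exact hcard h
    have hVinv : ∀ b ∈ A, ∀ u ∈ h • U, b • u ∈ h • U := by rw [hV]; exact hinv _ (hconj h)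
    have hdU := hdisj _ _ hVinv hUinv hcV hcU hne.1
    have hdU' := hdisj _ _ hVinv hUinv' hcV hcU' hne.2
    have hbot : h • U = ⊥ := by
      rw [AddSubgroup.eq_bot_iff_forall]
      intro z hz
      obtain ⟨u, hu, u', hu', rfl⟩ := AddSubgroup.mem_sup.mp (htop ▸ AddSubgroup.mem_top z)
      have hau : a • u = u := hu
      have h1 : a • (u + u') - (u + u') = a • u' - u' := by rw [smul_add, hau]; abel
      have h2 : a • u' - u' = 0 := by
        rw [← AddSubgroup.mem_bot, ← hdU']
        exact ⟨h1 ▸ AddSubgroup.sub_mem _ (hVinv a ha _ hz) hz,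
          AddSubgroup.sub_mem _ (hUinv' a ha _ hu') hu'⟩
      have h3 : u' ∈ U := sub_eq_zero.mp h2
      rw [← AddSubgroup.mem_bot, ← hdU]
      exact ⟨hz, AddSubgroup.add_mem _ hu h3⟩
    rw [hbot, AddSubgroup.card_bot] at hcV
    omega
  have htwo' : ∀ h : H, h • U' = U ∨ h • U' = U' := fun h => by
    rw [hU'def, smul_smul]; exact htwo (h * k)
  have hsq : ∀ h : H, h ^ 2 • U = U ∧ h ^ 2 • U' = U' := by
    intro h
    rw [pow_two, mul_smul, mul_smul]
    obtain h1 | h1 := htwo h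
    · obtain h2 | h2 := htwo' h
      · exact absurd (smul_left_cancel h (h2.trans h1.symm)) hk
      · rw [h1, h1, h2, h2]; exact ⟨rfl, rfl⟩
    · obtain h2 | h2 := htwo' h
      · rw [h1, h2, h1]; exact ⟨rfl, rfl⟩
      · exact absurd (smul_left_cancel h (h2.trans h1.symm)) hk
  refine card_lt_of_forall_smul_mem hW hcU hcU' hd (fun h hh u hu => ?_) fun h hh u hu => ?_
  · have : h ∈ stabilizer H U := mem_of_odd_of_sq_mem hh (hsq h).1
    exact (mem_stabilizer_iff.mp this).le (AddSubgroup.smul_mem_pointwise_smul u h _ hu)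
  · have : h ∈ stabilizer H U' := mem_of_odd_of_sq_mem hh (hsq h).2
    exact (mem_stabilizer_iff.mp this).le (AddSubgroup.smul_mem_pointwise_smul u h _ hu)

theorem card_odd_lt_of_irreducible [Finite W] [Finite H] [FaithfulSMul H W] [Group.IsSolvable H]
    (hirr : ∀ U : AddSubgroup W, (∀ h : H, ∀ a ∈ U, h • a ∈ U) → U = ⊥ ∨ U = ⊤)
    (hW : Nat.card W = 2 ^ 4) : Nat.card {h : H // Odd (orderOf h)} < 256 := by
  have hnt : Nontrivial W := Finite.one_lt_card_iff_nontrivial.mp (by rw [hW]; norm_num)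
  have hsub : Nat.card {h : H // Odd (orderOf h)} ≤ Nat.card H :=
    Nat.card_le_card_of_injective _ Subtype.val_injective
  obtain hH | hH := subsingleton_or_nontrivial H
  · exact hsub.trans_lt (by rw [Nat.card_unique]; norm_num)
  obtain ⟨A, r, hAn, hA1, hr, hAc, hAr⟩ := exists_normal_elementary_abelian H
  have hfix : ∀ w : W, (∀ a ∈ A, a • w = w) → w = 0 := fun w hw =>
    eq_zero_of_forall_mem_smul_eq hirr hAn hA1 hw
  have hr15 : r ∣ 15 := by
    have h1 := card_modEq_one hr (isPGroup_of_pow_eq_one hAr) hfix (U := ⊤)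
      fun _ _ _ _ => AddSubgroup.mem_top _
    rw [AddSubgroup.card_top, hW] at h1
    exact (Nat.modEq_iff_dvd' (by norm_num)).mp h1.symm
  have hr35 : r = 3 ∨ r = 5 := by
    rw [show 15 = 3 * 5 from rfl, hr.dvd_mul, Nat.prime_dvd_prime_iff_eq hr Nat.prime_three,
      Nat.prime_dvd_prime_iff_eq hr Nat.prime_five] at hr15
    exact hr15
  obtain rfl | rfl := hr35
  · by_cases hfree : ∀ a ∈ A, a ≠ 1 → fixedAddSubgroup W a = ⊥
    · exact card_odd_lt_of_fixedPointFree hW hAn hA1 hAr hfree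
    · push Not at hfree
      obtain ⟨a, ha, ha1, hFa⟩ := hfree
      exact card_odd_lt_of_fixedAddSubgroup_ne_bot hirr hW hAn hAc hAr hfix ha ha1 hFa
  · refine hsub.trans_lt ((card_le_of_semiregular hr hAn hA1 hAc hAr hfix fun U hU => ?_).trans_lt
      (by rw [hW]; norm_num))
    obtain ⟨j, hj, hc⟩ := (Nat.dvd_prime_pow Nat.prime_two).mp
      (hW ▸ AddSubgroup.card_addSubgroup_dvd_card U)
    rw [hc] at hU
    interval_cases j
    · exact Or.inl (AddSubgroup.card_eq_one.mp hc)
    · exact absurd hU (by decide)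
    · exact absurd hU (by decide)
    · exact absurd hU (by decide)
    · exact Or.inr ((AddSubgroup.card_eq_iff_eq_top _).mp (hc.trans hW.symm))

end Sixteen

theorem card_le_of_irreducible_of_card_eq_32 {W H : Type*} [AddCommGroup W] [Group H]
    [DistribMulAction H W] [Finite W] [Finite H] [FaithfulSMul H W] [Group.IsSolvable H]
    (hirr : ∀ U : AddSubgroup W, (∀ h : H, ∀ a ∈ U, h • a ∈ U) → U = ⊥ ∨ U = ⊤)
    (hW : Nat.card W = 2 ^ 5) : Nat.card H ≤ 930 := by
  have hnt : Nontrivial W := Finite.one_lt_card_iff_nontrivial.mp (by rw [hW]; norm_num)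
  obtain hH | hH := subsingleton_or_nontrivial H
  · rw [Nat.card_unique]; norm_num
  obtain ⟨A, r, hAn, hA1, hr, hAc, hAr⟩ := exists_normal_elementary_abelian H
  have hfix : ∀ w : W, (∀ a ∈ A, a • w = w) → w = 0 := fun w hw =>
    eq_zero_of_forall_mem_smul_eq hirr hAn hA1 hw
  have hr31 : r ∣ 31 := by
    have h1 := card_modEq_one hr (isPGroup_of_pow_eq_one hAr) hfix (U := ⊤)
      fun _ _ _ _ => AddSubgroup.mem_top _
    rw [AddSubgroup.card_top, hW] at h1
    exact (Nat.modEq_iff_dvd' (by norm_num)).mp h1.symm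
  obtain rfl : r = 31 := (Nat.prime_dvd_prime_iff_eq hr (by norm_num)).mp hr31
  refine (card_le_of_semiregular hr hAn hA1 hAc hAr hfix fun U hU => ?_).trans (by rw [hW]; norm_num)
  obtain ⟨j, hj, hc⟩ := (Nat.dvd_prime_pow Nat.prime_two).mp
    (hW ▸ AddSubgroup.card_addSubgroup_dvd_card U)
  rw [hc] at hU
  interval_cases j
  · exact Or.inl (AddSubgroup.card_eq_one.mp hc)
  · exact absurd hU (by decide)
  · exact absurd hU (by decide)
  · exact absurd hU (by decide)
  · exact absurd hU (by decide)
  · exact Or.inr ((AddSubgroup.card_eq_iff_eq_top _).mp (hc.trans hW.symm))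

theorem eq_bot_or_eq_top_of_stabilizer {G Ω : Type*} [Group G] [AddCommGroup Ω] [MulAction G Ω]
    (hirr : ∀ U : AddSubgroup Ω, (∀ g ∈ stabilizer G (0 : Ω), ∀ a ∈ U, g • a ∈ U) →
      U = ⊥ ∨ U = ⊤) (U : AddSubgroup Ω)
    (hU : ∀ h : stabilizer G (0 : Ω), ∀ a ∈ U, h • a ∈ U) : U = ⊥ ∨ U = ⊤ :=
  hirr U fun g hg => hU ⟨g, hg⟩

theorem oddFixWeight_lt_of_affine {G Ω : Type*} [Group G] [Fintype G] [AddCommGroup Ω]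
    [Finite Ω] [MulAction G Ω] [FaithfulSMul G Ω] [IsPretransitive G Ω] [Group.IsSolvable G]
    (hadd : ∀ g ∈ stabilizer G (0 : Ω), ∀ a b : Ω, g • (a + b) = g • a + g • b)
    (hirr : ∀ U : AddSubgroup Ω, (∀ g ∈ stabilizer G (0 : Ω), ∀ a ∈ U, g • a ∈ U) →
      U = ⊥ ∨ U = ⊤)
    {p : ℕ} (hp : p.Prime) (hpW : ∀ a : Ω, p • a = 0) (hN : 10 ≤ Nat.card Ω) :
    (∀ g : G, IsOddPrimary g → Nat.card (fixedBy Ω g) + 8 ≤ Nat.card Ω) ∧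
      oddFixWeight G Ω < 2 ^ (Nat.card Ω + 2) := by
  obtain ⟨n, hn⟩ := exists_card_eq_prime_pow hp hpW
  have hirr' := eq_bot_or_eq_top_of_stabilizer hirr
  rw [hn] at hN
  obtain rfl | hp2 := eq_or_ne p 2
  · have h4 : 4 ≤ n := by
      by_contra! h
      interval_cases n <;> omega
    obtain ⟨m, rfl⟩ := Nat.exists_eq_add_of_le' (show 2 ≤ n by omega)
    have hf : ∀ g : G, IsOddPrimary g → Nat.card (fixedBy Ω g) ≤ 2 ^ m := fun g hg =>
      card_fixedBy_le_two_pow hadd hn hg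
    refine ⟨fun g hg => ?_, ?_⟩
    · have h1 := hf g hg
      have h2 : 2 ^ 2 ≤ 2 ^ m := Nat.pow_le_pow_right two_pos (by omega)
      rw [hn, pow_add]
      omega
    obtain h5 | h5 := le_or_gt 5 m
    · exact oddFixWeight_lt_of_card_fixedBy_le hadd hp hpW hn
        (Nat.pow_le_pow_right two_pos (by omega)) hf (two_pow_bound h5)
    let _ := stabilizerDistribMulAction hadd
    obtain rfl | rfl | rfl : m = 2 ∨ m = 3 ∨ m = 4 := by omega
    · refine oddFixWeight_lt_of_card_eq_16 hadd hn (lt_of_le_of_lt ?_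
        (card_odd_lt_of_irreducible hirr' hn))
      exact Nat.card_le_card_of_injective (Subtype.map id fun h hh => hh.odd_orderOf)
        (Subtype.map_injective _ Function.injective_id)
    · exact oddFixWeight_lt_of_card_eq_32 hadd hn
        (card_le_of_irreducible_of_card_eq_32 hirr' hn)
    · exact oddFixWeight_lt_of_card_eq_64 hadd hpW hn
  obtain ⟨m, rfl⟩ : ∃ m, n = m + 1 := Nat.exists_eq_succ_of_ne_zero (by rintro rfl; simp at hN)
  have hf : ∀ g : G, IsOddPrimary g → Nat.card (fixedBy Ω g) ≤ p ^ m := fun g hg =>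
    card_fixedBy_le_pow hadd hp hn hg.1
  obtain rfl | hp3 := eq_or_ne p 3
  · have h2 : 2 ≤ m := by
      by_contra! h
      interval_cases m <;> omega
    refine ⟨fun g hg => ?_, ?_⟩
    · have h1 := hf g hg
      have h3 : 3 ^ 2 ≤ 3 ^ m := Nat.pow_le_pow_right three_pos h2
      rw [hn, pow_succ]
      omega
    obtain rfl | h3 := h2.eq_or_lt
    · exact oddFixWeight_lt_of_card_eq_27 hadd hpW hn
    · obtain ⟨k, rfl⟩ := Nat.exists_eq_add_of_le' (show 1 ≤ m by omega)
      exact oddFixWeight_lt_of_card_fixedBy_le hadd hp hpW hn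
        (Nat.pow_le_pow_right three_pos (by omega)) hf (three_pow_bound (by omega))
  have hp5 : 5 ≤ p := by
    have := hp.two_le
    by_contra! h
    interval_cases p
    · exact hp2 rfl
    · exact hp3 rfl
    · exact absurd hp (by norm_num)
  have hN' : 10 < p ^ (m + 1) := by
    refine hN.lt_of_ne fun h => hp2 ?_
    have h2 : 2 ∣ p ^ (m + 1) := ⟨5, by omega⟩
    exact ((Nat.prime_dvd_prime_iff_eq Nat.prime_two hp).mp
      (Nat.prime_two.dvd_of_dvd_pow h2)).symm
  have hf' : ∀ g : G, IsOddPrimary g → Nat.card (fixedBy Ω g) ≤ p ^ (m + 1) / 5 := by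
    intro g hg
    rw [Nat.le_div_iff_mul_le (by norm_num), pow_succ]
    exact Nat.mul_le_mul (hf g hg) hp5
  refine ⟨fun g hg => ?_, oddFixWeight_lt_of_card_fixedBy_le hadd hp hpW hn (Nat.div_le_self _ _)
    hf' (prime_pow_bound hp5 (by omega) hN')⟩
  have := hf' g hg
  rw [hn]
  omega

/-- Corollary 2.5: a primitive solvable permutation group of degree > 9 is nice. -/
theorem stmt_13 {Ω : Type*} [Fintype Ω] (G : Subgroup (Equiv.Perm Ω))
    (hsolv : IsSolvable G) (hprim : IsPrimitivePermGroup Ω G)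
    (hcard : 9 < Fintype.card Ω) :
    IsNice Ω G := by
  have : Group.IsSolvable G := hsolv
  have := hprim.1
  have : IsPreprimitive G Ω := { isTrivialBlock_of_isBlock := fun {B} hB => hprim.2 B hB }
  have hnt : Nontrivial Ω := Fintype.one_lt_card_iff_nontrivial.mp (by omega)
  have := Fintype.ofFinite G
  obtain ⟨x⟩ := hnt.to_nonempty
  obtain ⟨p, hp, _, rfl, hpW, hadd, hirr⟩ := exists_affine_structure (G := G) x
  rw [← Nat.card_eq_fintype_card] at hcard
  obtain ⟨hf, hG⟩ := oddFixWeight_lt_of_affine hadd hirr hp hpW hcard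
  exact isNice_of_oddFixWeight_lt G hcard hf hG
end

section
/- Let Ω be a finite set with 2 ≤ |Ω| ≤ 9 and let G be a solvable subgroup of the symmetric group on Ω acting primitively on Ω. Then (G, Ω) is nice: there exist subsets Δ₁, Δ₂ of Ω with |Δ₁| < |Δ₂| and 2|Δ₂| ≤ |Ω| such that for j = 1, 2, the setwise stabilizer of Δ_j in G has a normal elementary abelian 3-subgroup (possibly trivial) with 2-group quotient. -/
open Pointwise

theorem requiredStructure_of_pow_twelve {S : Type*} [Group S] (h12 : ∀ x : S, x ^ 12 = 1)
    (hc : ∀ x y : S, x ^ 3 = 1 → y ^ 3 = 1 → x * y = y * x) : RequiredStructure S := by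
  let N : Subgroup S :=
    { carrier := {x | x ^ 3 = 1}
      mul_mem' := fun {x y} hx hy => by
        have h : Commute x y := hc x y hx hy
        simp only [Set.mem_ofPred_eq] at hx hy ⊢
        rw [h.mul_pow, hx, hy, one_mul]
      one_mem' := one_pow 3
      inv_mem' := fun {x} hx => by
        simp only [Set.mem_ofPred_eq] at hx ⊢
        rw [inv_pow, hx, inv_one] }
  have hN : N.Normal := ⟨fun x (hx : x ^ 3 = 1) g => by
    change (g * x * g⁻¹) ^ 3 = 1
    rw [conj_pow, hx, mul_one, mul_inv_cancel]⟩
  refine ⟨N, hN, fun x hx y hy => hc x y hx hy, fun x hx => hx, fun q => ?_⟩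
  induction q using QuotientGroup.induction_on with
  | H x =>
    refine ⟨2, ?_⟩
    rw [← QuotientGroup.mk_pow, QuotientGroup.eq_one_iff]
    change (x ^ 2 ^ 2) ^ 3 = 1
    rw [← pow_mul]
    exact h12 x

theorem requiredStructure_of_card_le_three {S T : Type*} [Group S] [MulAction S T]
    [FaithfulSMul S T] [Finite T] (hT : Nat.card T ≤ 3) : RequiredStructure S := by
  have := Fintype.ofFinite T
  have hT' : Fintype.card T ≤ Fintype.card (Fin 3) := by
    rwa [Fintype.card_fin, ← Nat.card_eq_fintype_card]
  obtain ⟨e⟩ := Function.Embedding.nonempty_of_card_le hT'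
  let f : S →* Equiv.Perm (Fin 3) :=
    (Equiv.Perm.viaEmbeddingHom e).comp (MulAction.toPermHom S T)
  have hf : Function.Injective f :=
    (Equiv.Perm.viaEmbeddingHom_injective e).comp MulAction.toPerm_injective
  have h12 : ∀ x : Equiv.Perm (Fin 3), x ^ 6 = 1 := by
    set_option maxRecDepth 10000 in decide
  have hc : ∀ x y : Equiv.Perm (Fin 3), x ^ 3 = 1 → y ^ 3 = 1 → x * y = y * x := by
    set_option maxRecDepth 10000 in decide
  refine requiredStructure_of_pow_twelve (fun x => hf ?_) fun x y hx hy => hf ?_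
  · rw [map_pow, map_one, show 12 = 6 * 2 from rfl, pow_mul, h12, one_pow]
  · rw [map_mul, map_mul]
    exact hc _ _ (by rw [← map_pow, hx, map_one]) (by rw [← map_pow, hy, map_one])

section Action

variable {G Ω : Type*} [Group G] [MulAction G Ω]

theorem requiredStructure_stabilizer_of_ncard_eq_three {T : Set Ω} (hT : T.ncard = 3)
    (h : ∀ g : G, (∀ x ∈ T, g • x = x) → g = 1) :
    RequiredStructure (MulAction.stabilizer G T) := by
  have : FaithfulSMul (MulAction.stabilizer G T) T := by
    refine ⟨fun {g₁ g₂} hg => ?_⟩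
    have h1 : (g₂⁻¹ * g₁ : G) = 1 := h _ fun x hx => by
      have := congrArg Subtype.val (hg ⟨x, hx⟩)
      rw [mul_smul]
      exact inv_smul_eq_iff.mpr this
    exact Subtype.ext (inv_mul_eq_one.mp h1).symm
  have : Finite T := Set.finite_of_ncard_ne_zero (by omega)
  exact requiredStructure_of_card_le_three (S := MulAction.stabilizer G T) (T := T)
    (by rw [Nat.card_coe_set_eq, hT])

theorem requiredStructure_stabilizer_pair {a b : Ω}
    (h6 : ∀ g : G, g • a = a → g • b = b → g ^ 6 = 1)
    (hc : ∀ g h : G, g • a = a → g • b = b → h • a = a → h • b = b → g ^ 3 = 1 → h ^ 3 = 1 →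
      g * h = h * g) :
    RequiredStructure (MulAction.stabilizer G ({a, b} : Set Ω)) := by
  have hsq : ∀ x : MulAction.stabilizer G ({a, b} : Set Ω),
      (x : G) ^ 2 • a = a ∧ (x : G) ^ 2 • b = b := by
    rintro ⟨x, hx⟩
    rw [MulAction.mem_stabilizer_iff] at hx
    have ha : x • a ∈ ({a, b} : Set Ω) := hx ▸ Set.smul_mem_smul_set (by simp)
    have hb : x • b ∈ ({a, b} : Set Ω) := hx ▸ Set.smul_mem_smul_set (by simp)
    have hinj : x • a = x • b → a = b := fun h => smul_left_cancel x h
    simp only [Set.mem_insert_iff, Set.mem_singleton_iff] at ha hb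
    simp only [pow_two, mul_smul]
    rcases ha with ha | ha <;> rcases hb with hb | hb
    · simp [ha, hb]
      grind
    · simp [ha, hb]
    · simp [ha, hb]
    · simp [ha, hb]
      grind
  refine requiredStructure_of_pow_twelve (fun x => Subtype.ext ?_) fun x y hx hy => Subtype.ext ?_
  · have := h6 _ (hsq x).1 (hsq x).2
    rw [← pow_mul] at this
    simpa using this
  · have key : ∀ z : MulAction.stabilizer G ({a, b} : Set Ω), z ^ 3 = 1 →
        (z : G) • a = a ∧ (z : G) • b = b := by
      intro z hz
      have hz' : (z : G) = ((z ^ 2 : MulAction.stabilizer G ({a, b} : Set Ω)) : G) ^ 2 := by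
        rw [← Subgroup.coe_pow, ← pow_mul, show 2 * 2 = 3 + 1 from rfl, pow_succ, hz, one_mul]
      rw [hz']
      exact hsq (z ^ 2)
    exact hc _ _ (key x hx).1 (key x hx).2 (key y hy).1 (key y hy).2
      (by simpa using congrArg Subtype.val hx) (by simpa using congrArg Subtype.val hy)

theorem eq_one_of_commute_of_smul_eq [FaithfulSMul G Ω] {A : Set G} {g : G} {x : Ω}
    (hA : ∀ y, g • y = y ∨ ∃ c ∈ A, c • x = y) (hg : ∀ c ∈ A, g * c = c * g)
    (hx : g • x = x) : g = 1 := by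
  refine eq_of_smul_eq_smul (α := Ω) fun y => ?_
  rw [one_smul]
  rcases hA y with h | ⟨c, hc, rfl⟩
  · exact h
  · rw [← mul_smul, hg c hc, mul_smul, hx]

theorem exists_normal_comm_pow_eq_one {K : Type*} [Group K] [Finite K] [Group.IsSolvable K]
    [Nontrivial K] :
    ∃ (p : ℕ) (N : Subgroup K), p.Prime ∧ N.Normal ∧ N ≠ ⊥ ∧
      (∀ x ∈ N, ∀ y ∈ N, x * y = y * x) ∧ ∀ x ∈ N, x ^ p = 1 := by
  classical
  obtain ⟨n, hn, hn'⟩ : ∃ n, derivedSeries K n ≠ ⊥ ∧ derivedSeries K (n + 1) = ⊥ := by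
    have h : ∃ n, derivedSeries K n = ⊥ := Group.IsSolvable.solvable
    have h0 : Nat.find h ≠ 0 := fun h0 => by
      have := Nat.find_spec h
      rw [h0, derivedSeries_zero] at this
      exact top_ne_bot this
    refine ⟨Nat.find h - 1, Nat.find_min h (by omega), ?_⟩
    rw [Nat.sub_add_cancel (by omega)]
    exact Nat.find_spec h
  set D := derivedSeries K n
  have hD : ∀ x ∈ D, ∀ y ∈ D, x * y = y * x := fun x hx y hy => by
    rw [← commutatorElement_eq_one_iff_mul_comm, ← Subgroup.mem_bot, ← hn', derivedSeries_succ]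
    exact Subgroup.commutator_mem_commutator hx hy
  have hcard : Nat.card D ≠ 1 := fun h => hn (Subgroup.card_eq_one.mp h)
  have hp := Nat.minFac_prime hcard
  have := Fact.mk hp
  obtain ⟨d, hd⟩ := exists_prime_orderOf_dvd_card' (G := D) _ (Nat.minFac_dvd (Nat.card D))
  let N : Subgroup K :=
    { carrier := {x | x ∈ D ∧ x ^ (Nat.card D).minFac = 1}
      mul_mem' := fun {x y} hx hy => by
        have h : Commute x y := hD x hx.1 y hy.1
        refine ⟨mul_mem hx.1 hy.1, ?_⟩
        rw [h.mul_pow, hx.2, hy.2, one_mul]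
      one_mem' := ⟨one_mem _, one_pow _⟩
      inv_mem' := fun {x} hx => ⟨inv_mem hx.1, by rw [inv_pow, hx.2, inv_one]⟩ }
  refine ⟨_, N, hp, ⟨fun x hx g => ⟨(derivedSeries_normal K n).conj_mem x hx.1 g, ?_⟩⟩, ?_,
    fun x hx y hy => hD x hx.1 y hy.1, fun x hx => hx.2⟩
  · rw [conj_pow, hx.2, mul_one, mul_inv_cancel]
  · intro h
    have hd1 : (d : K) ∈ N := ⟨d.2, by rw [← hd, ← Subgroup.coe_pow, pow_orderOf_eq_one]; rfl⟩
    rw [h, Subgroup.mem_bot, OneMemClass.coe_eq_one] at hd1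
    rw [hd1, orderOf_one] at hd
    exact hp.one_lt.ne hd

theorem commute_and_pow_of_normal_prime {K : Type*} [Group K] (N : Subgroup K) [N.Normal]
    {p : ℕ} (hp : p.Prime) (hN : Nat.card N = p) (H : Subgroup K)
    (hH : ∀ x ∈ H, (∀ n ∈ N, x * n = n * x) → x = 1) :
    (∀ x ∈ H, ∀ y ∈ H, x * y = y * x) ∧ ∀ x ∈ H, x ^ (p - 1) = 1 := by
  have := Fact.mk hp
  have : IsCyclic N := isCyclic_of_prime_card hN
  let e := IsCyclic.mulAutMulEquiv N
  let f : K →* (ZMod (Nat.card N))ˣ := e.toMonoidHom.comp MulAut.conjNormal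
  have hf : ∀ x ∈ H, f x = 1 → x = 1 := fun x hx h => hH x hx fun n hn => by
    have h1 : MulAut.conjNormal x = (1 : MulAut N) := e.injective (h.trans (map_one e).symm)
    have h2 := MulAut.conjNormal_apply x (⟨n, hn⟩ : N)
    rw [h1] at h2
    exact (mul_inv_eq_iff_eq_mul.mp h2.symm)
  refine ⟨fun x hx y hy => ?_, fun x hx => hf _ (pow_mem hx _) ?_⟩
  · have := hf ((y * x)⁻¹ * (x * y)) (mul_mem (inv_mem (mul_mem hy hx)) (mul_mem hx hy))
      (by simp [mul_comm (f x)])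
    exact (inv_mul_eq_one.mp this).symm
  · rw [map_pow]
    generalize f x = u
    revert u
    rw [hN]
    exact ZMod.units_pow_card_sub_one_eq_one p

theorem exists_mem_zpowers_smul_eq [Finite Ω] [FaithfulSMul G Ω] {p : ℕ} (hp : p.Prime)
    (hΩ : Nat.card Ω = p + 1) {b : G} (hb : b ^ p = 1) (hb1 : b ≠ 1) {a : Ω} (ha : b • a = a)
    {u v : Ω} (hu : u ≠ a) (hv : v ≠ a) : ∃ z ∈ Subgroup.zpowers b, z • u = v := by
  have := Fact.mk hp
  have hord : orderOf b = p := orderOf_eq_prime hb hb1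
  have hZ : Nat.card (Subgroup.zpowers b) = p ^ 1 := by rw [Nat.card_zpowers, hord, pow_one]
  have hZp := IsPGroup.of_card hZ
  have hfix_mem : ∀ x : Ω, x ∈ MulAction.fixedPoints (Subgroup.zpowers b) Ω ↔ b • x = x := by
    refine fun x => ⟨fun h => h ⟨b, Subgroup.mem_zpowers b⟩, fun h => ?_⟩
    rintro ⟨z, hz⟩
    have : Subgroup.zpowers b ≤ MulAction.stabilizer G x := by
      rw [Subgroup.zpowers_le]
      exact h
    exact this hz
  set F := MulAction.fixedPoints (Subgroup.zpowers b) Ω with hF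
  have hmod := hZp.card_modEq_card_fixedPoints Ω
  have hne : F ≠ Set.univ := fun h => hb1 <| eq_of_smul_eq_smul (α := Ω) fun x => by
    rw [one_smul, ← hfix_mem, h]
    trivial
  have hlt : F.ncard < p + 1 := by
    rw [← hΩ, ← Set.ncard_univ]
    exact Set.ncard_lt_ncard (Set.ssubset_univ_iff.mpr hne)
  have hpos : 0 < F.ncard := (Set.ncard_pos).mpr ⟨a, (hfix_mem a).mpr ha⟩
  have hF1 : F.ncard = 1 := by
    rw [Nat.card_coe_set_eq, hΩ, ← hF] at hmod
    have h1 : F.ncard ≡ 1 [MOD p] := hmod.symm.trans (by simp [Nat.ModEq])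
    have h2 : p ∣ F.ncard - 1 := (Nat.modEq_iff_dvd' hpos).mp h1.symm
    have := Nat.eq_zero_of_dvd_of_lt h2 (by omega)
    omega
  obtain ⟨c, hc⟩ := Set.ncard_eq_one.mp hF1
  have hac : a = c := by
    have := (hfix_mem a).mpr ha
    rwa [hc] at this
  subst hac
  obtain ⟨k, hk⟩ := hZp.card_orbit u
  have hk0 : k ≠ 0 := by
    rintro rfl
    apply hu
    have : u ∈ F := by
      have := Fintype.ofFinite (MulAction.orbit (Subgroup.zpowers b) u)
      rw [hF, MulAction.mem_fixedPoints_iff_card_orbit_eq_one, ← Nat.card_eq_fintype_card, hk,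
        pow_zero]
    rwa [hc] at this
  have hsub : MulAction.orbit (Subgroup.zpowers b) u ⊆ {a}ᶜ := by
    rintro _ ⟨z, rfl⟩ h
    apply hu
    have ha' : a ∈ F := (hfix_mem a).mpr ha
    have h' : z • u = z • a := by
      rw [ha' z]
      exact h
    exact smul_left_cancel z h'
  have hcompl : ({a}ᶜ : Set Ω).ncard = p := by
    rw [Set.ncard_compl, Set.ncard_singleton, hΩ, Nat.add_sub_cancel]
  have heq : MulAction.orbit (Subgroup.zpowers b) u = {a}ᶜ := by
    refine Set.eq_of_subset_of_ncard_le hsub ?_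
    rw [hcompl, ← Nat.card_coe_set_eq, hk]
    exact Nat.le_self_pow hk0 p
  have hv' : v ∈ MulAction.orbit (Subgroup.zpowers b) u := by
    rw [heq]
    exact hv
  obtain ⟨z, hz⟩ := hv'
  exact ⟨z, z.2, hz⟩

section FixedPoint

variable [Finite Ω] [FaithfulSMul G Ω] {p : ℕ} (hp : p.Prime)
    (hΩ : Nat.card Ω = p + 1) {a : Ω} (ha : ∀ g : G, g • a = a) (B : Subgroup G)
    (hcomm : ∀ x ∈ B, ∀ y ∈ B, x * y = y * x) (hpow : ∀ x ∈ B, x ^ p = 1)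

include hp hΩ ha hpow

theorem eq_one_of_commute_of_fixed {b : G} (hb : b ∈ B) (hb1 : b ≠ 1) {g : G}
    (hg : g * b = b * g) {v : Ω} (hv : v ≠ a) (hgv : g • v = v) : g = 1 := by
  refine eq_one_of_commute_of_smul_eq (A := Subgroup.zpowers b) (x := v) (fun y => ?_) ?_ hgv
  · by_cases hy : y = a
    · exact Or.inl (hy ▸ ha g)
    · exact Or.inr (exists_mem_zpowers_smul_eq hp hΩ (hpow b hb) hb1 (ha b) hv hy)
  · intro c hc
    obtain ⟨k, rfl⟩ := Subgroup.mem_zpowers_iff.mp hc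
    exact Commute.zpow_right hg k

variable [B.Normal]

include hcomm

theorem eq_one_of_fixes_two {g : G} {v w : Ω} (hv : v ≠ a) (hw : w ≠ a) (hvw : v ≠ w)
    (hB : B ≠ ⊥) (hgv : g • v = v) (hgw : g • w = w) : g = 1 := by
  obtain ⟨b, hb, hb1⟩ := (Subgroup.bot_or_exists_ne_one B).resolve_left hB
  obtain ⟨c, hc, hcv⟩ := exists_mem_zpowers_smul_eq hp hΩ (hpow b hb) hb1 (ha b) hv hw
  have hcB : c ∈ B := (Subgroup.zpowers_le.mpr hb) hc
  have hc1 : c ≠ 1 := by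
    rintro rfl
    exact hvw (by rw [← hcv, one_smul])
  have hconj : g * c * g⁻¹ ∈ B := Subgroup.Normal.conj_mem inferInstance c hcB g
  have hgv' : g⁻¹ • v = v := inv_smul_eq_iff.mpr hgv.symm
  have hcw : c⁻¹ • w = v := inv_smul_eq_iff.mpr hcv.symm
  have h1 : c⁻¹ * (g * c * g⁻¹) = 1 := by
    have hm : c⁻¹ * (g * c * g⁻¹) ∈ B := mul_mem (inv_mem hcB) hconj
    refine eq_one_of_commute_of_fixed hp hΩ ha B hpow hcB hc1 (hcomm _ hm _ hcB) hv ?_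
    simp only [mul_smul, hgv', hcv, hgw, hcw]
  have h2 : g * c = c * g := mul_inv_eq_iff_eq_mul.mp (inv_mul_eq_one.mp h1).symm
  exact eq_one_of_commute_of_fixed hp hΩ ha B hpow hcB hc1 h2 hv hgv

theorem commute_and_pow_of_fixes_one {v : Ω} (hv : v ≠ a) (hB : B ≠ ⊥) :
    (∀ g h : G, g • v = v → h • v = v → g * h = h * g) ∧
      ∀ g : G, g • v = v → g ^ (p - 1) = 1 := by
  obtain ⟨b, hb, hb1⟩ := (Subgroup.bot_or_exists_ne_one B).resolve_left hB
  have hcard : Nat.card B = p := by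
    have hBZ : B = Subgroup.zpowers b := by
      refine le_antisymm (fun c hc => ?_) (Subgroup.zpowers_le.mpr hb)
      by_cases hcv : c • v = v
      · rw [eq_one_of_commute_of_fixed hp hΩ ha B hpow hb hb1 (hcomm c hc b hb) hv hcv]
        exact one_mem _
      · have hca : c • v ≠ a := fun h => hv (smul_left_cancel c (h.trans (ha c).symm))
        obtain ⟨z, hz, hzv⟩ :=
          exists_mem_zpowers_smul_eq hp hΩ (hpow b hb) hb1 (ha b) hv hca
        have hzB : z ∈ B := (Subgroup.zpowers_le.mpr hb) hz
        have hm : z⁻¹ * c ∈ B := mul_mem (inv_mem hzB) hc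
        have := eq_one_of_commute_of_fixed hp hΩ ha B hpow hb hb1 (hcomm _ hm b hb) hv
          (by rw [mul_smul, ← hzv, inv_smul_smul])
        rwa [← inv_mul_eq_one.mp this]
    rw [hBZ, Nat.card_zpowers]
    have := Fact.mk hp
    exact orderOf_eq_prime (hpow b hb) hb1
  have := commute_and_pow_of_normal_prime B hp hcard (MulAction.stabilizer G v)
    fun x hx hc => eq_one_of_commute_of_fixed hp hΩ ha B hpow hb hb1 (hc b hb) hv hx
  exact ⟨fun g h hg hh => this.1 g hg h hh, fun g hg => this.2 g hg⟩

end FixedPoint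

theorem stabilizer_ne_bot_of_not_prime [Finite G] [Nontrivial Ω] [MulAction.IsPreprimitive G Ω]
    (hΩ : ¬ (Nat.card Ω).Prime) (a : Ω) : MulAction.stabilizer G a ≠ ⊥ := by
  intro h
  have hco := MulAction.IsPreprimitive.isCoatom_stabilizer_of_isPreprimitive (G := G) a
  rw [h] at hco
  have hcard : Nat.card G = Nat.card Ω := by
    have := MulAction.index_stabilizer_of_transitive G a
    rwa [h, Subgroup.index_bot] at this
  have hne : Nat.card G ≠ 1 := fun h1 => by
    have : Subsingleton Ω := by
      have : Finite Ω := Nat.finite_of_card_ne_zero (by omega)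
      exact (Nat.card_eq_one_iff_unique.mp (hcard ▸ h1)).1
    exact not_subsingleton Ω this
  have := Fact.mk (Nat.minFac_prime hne)
  obtain ⟨d, hd⟩ := exists_prime_orderOf_dvd_card' (G := G) _ (Nat.minFac_dvd _)
  have htop : Subgroup.zpowers d = ⊤ := by
    refine hco.2 _ (bot_lt_iff_ne_bot.mpr fun hbot => ?_)
    rw [Subgroup.zpowers_eq_bot] at hbot
    rw [hbot, orderOf_one] at hd
    exact (Nat.minFac_prime hne).one_lt.ne hd
  apply hΩ
  rw [← hcard, ← Subgroup.card_top, ← htop, Nat.card_zpowers, hd]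
  exact Nat.minFac_prime hne

section Primitive

variable [FaithfulSMul G Ω]

theorem isPretransitive_of_normal_of_ne_bot [MulAction.IsPreprimitive G Ω] (N : Subgroup G)
    [N.Normal] (hN : N ≠ ⊥) : MulAction.IsPretransitive N Ω := by
  refine MulAction.IsQuasiPreprimitive.isPretransitive_of_normal (G := G) fun h => ?_
  obtain ⟨b, hb, hb1⟩ := (Subgroup.bot_or_exists_ne_one N).resolve_left hN
  refine hb1 (eq_of_smul_eq_smul (α := Ω) fun x => ?_)
  have hx : x ∈ MulAction.fixedPoints N Ω := by
    rw [h]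
    trivial
  rw [one_smul]
  exact hx ⟨b, hb⟩

section Regular

variable (A : Subgroup G) [MulAction.IsPretransitive A Ω]

theorem eq_one_of_commute_of_isPretransitive {g : G} {x : Ω} (hg : ∀ c ∈ A, g * c = c * g)
    (hx : g • x = x) : g = 1 :=
  eq_one_of_commute_of_smul_eq (A := A) (x := x)
    (fun y => Or.inr ((MulAction.exists_smul_eq A x y).imp' Subtype.val
      fun c hc => ⟨c.2, hc⟩)) hg hx

variable (hA : ∀ x ∈ A, ∀ y ∈ A, x * y = y * x)

include hA

theorem card_eq_of_isPretransitive_of_commute [Nonempty Ω] : Nat.card A = Nat.card Ω := by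
  obtain ⟨a⟩ := ‹Nonempty Ω›
  refine Nat.card_congr (Equiv.ofBijective (fun c : A => c • a) ⟨fun c d h => ?_,
    MulAction.exists_smul_eq A a⟩)
  have h1 : (d⁻¹ * c : G) = 1 := by
    refine eq_one_of_commute_of_isPretransitive A (x := a)
      (hA _ (mul_mem (inv_mem d.2) c.2)) ?_
    rw [mul_smul]
    exact inv_smul_eq_iff.mpr h
  exact Subtype.ext (inv_mul_eq_one.mp h1).symm

theorem mul_comm_of_fixes [A.Normal] {c g : G} {a : Ω} (hc : c ∈ A) (hg : g • a = a)
    (hgc : g • c • a = c • a) : g * c = c * g := by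
  have h1 : c⁻¹ * (g * c * g⁻¹) = 1 := by
    refine eq_one_of_commute_of_isPretransitive A (x := a)
      (hA _ (mul_mem (inv_mem hc) (Subgroup.Normal.conj_mem inferInstance c hc g))) ?_
    simp only [mul_smul, inv_smul_eq_iff.mpr hg.symm, hgc, inv_smul_smul]
  exact mul_inv_eq_iff_eq_mul.mp (inv_mul_eq_one.mp h1).symm

theorem eq_of_fixed_by_normal_subgroup [A.Normal] [Nontrivial Ω] [MulAction.IsPreprimitive G Ω]
    {a : Ω} (B : Subgroup (MulAction.stabilizer G a)) [B.Normal] (hB : B ≠ ⊥) {x : Ω}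
    (hx : ∀ b ∈ B, (b : G) • x = x) : x = a := by
  set B' : Subgroup G := B.map (MulAction.stabilizer G a).subtype with hB'
  have hB'bot : B' ≠ ⊥ := fun h =>
    hB ((Subgroup.map_eq_bot_iff_of_injective B (Subgroup.subtype_injective _)).mp h)
  have hfix : ∀ b ∈ B', b • a = a := by
    rintro _ ⟨b, -, rfl⟩
    exact b.2
  have hle : MulAction.stabilizer G a ≤ Subgroup.normalizer (B' : Set G) := by
    have := Subgroup.le_normalizer_map (H := B) (MulAction.stabilizer G a).subtype
    rw [Subgroup.normalizer_eq_top, ← MonoidHom.range_eq_map, Subgroup.range_subtype] at this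
    exact this
  have hco := MulAction.IsPreprimitive.isCoatom_stabilizer_of_isPreprimitive (G := G) a
  have hnorm : Subgroup.normalizer (B' : Set G) = MulAction.stabilizer G a := by
    refine (hco.le_iff.mp hle).resolve_left fun htop => ?_
    have : B'.Normal := Subgroup.normalizer_eq_top_iff.mp htop
    have := isPretransitive_of_normal_of_ne_bot (Ω := Ω) B' hB'bot
    obtain ⟨y, hy⟩ := exists_ne a
    obtain ⟨b, hb⟩ := MulAction.exists_smul_eq B' a y
    exact hy (hb.symm.trans (hfix b b.2))
  obtain ⟨⟨c, hc⟩, hca : c • a = x⟩ := MulAction.exists_smul_eq A a x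
  have hcomm : ∀ b ∈ B', b * c = c * b := by
    intro b hb
    refine mul_comm_of_fixes A hA hc (hfix b hb) ?_
    rw [hca]
    obtain ⟨b, hb, rfl⟩ := hb
    exact hx b hb
  have hcn : c ∈ MulAction.stabilizer G a := by
    rw [← hnorm, Subgroup.mem_normalizer_iff]
    refine fun b => ⟨fun hb => ?_, fun hb => ?_⟩
    · rwa [← hcomm b hb, mul_inv_cancel_right]
    · have := hcomm _ hb
      rw [inv_mul_cancel_right, mul_assoc, mul_right_inj] at this
      rwa [mul_assoc, ← this] at hb
  rw [← hca]
  exact hcn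

end Regular

section DegreeNine

variable [Finite G] (A : Subgroup G) [MulAction.IsPretransitive A Ω]
    (hA : ∀ x ∈ A, ∀ y ∈ A, x * y = y * x) (hpow : ∀ x ∈ A, x ^ 3 = 1) (hcard : Nat.card A = 9)
    {v w : G} (hv : v ∈ A) (hv1 : v ≠ 1) (hvw : w ∉ Subgroup.zpowers v)

include hpow hcard hv hv1 hvw

theorem eq_of_le_of_mem_of_notMem_zpowers {K : Subgroup G} (hK : K ≤ A) (hvK : v ∈ K)
    (hwK : w ∈ K) : K = A := by
  refine Subgroup.eq_of_le_of_card_ge hK ?_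
  have hle : Subgroup.zpowers v ≤ K := Subgroup.zpowers_le.mpr hvK
  have h3 : Nat.card (Subgroup.zpowers v) = 3 := by
    rw [Nat.card_zpowers]
    exact orderOf_eq_prime (hpow v hv) hv1
  have h9 : Nat.card K ∣ 3 ^ 2 := by
    have := Subgroup.card_dvd_of_le hK
    rwa [hcard] at this
  obtain ⟨k, hk, hk'⟩ := (Nat.dvd_prime_pow Nat.prime_three).mp h9
  have hne : Nat.card K ≠ 3 := fun h => by
    have := Subgroup.eq_of_le_of_card_ge hle (by rw [h, h3])
    exact hvw (this ▸ hwK)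
  have hge : 3 ≤ Nat.card K := h3 ▸ Subgroup.card_le_of_le hle
  rw [hcard]
  interval_cases k <;> omega

variable (hw : w ∈ A)

include hw

theorem eq_one_of_commute_two {g : G} {a : Ω} (hga : g • a = a) (hgv : g * v = v * g)
    (hgw : g * w = w * g) : g = 1 := by
  have h := eq_of_le_of_mem_of_notMem_zpowers A hpow hcard hv hv1 hvw
    (K := A ⊓ Subgroup.centralizer {g}) inf_le_left
    ⟨hv, Subgroup.mem_centralizer_singleton_iff.mpr hgv.symm⟩
    ⟨hw, Subgroup.mem_centralizer_singleton_iff.mpr hgw.symm⟩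
  refine eq_one_of_commute_of_isPretransitive A (x := a) (fun c hc => ?_) hga
  rw [← h] at hc
  exact (Subgroup.mem_centralizer_singleton_iff.mp hc.2).symm

include hA

theorem exists_eq_zpow_mul_zpow {x : G} (hx : x ∈ A) : ∃ i j : ℤ, x = v ^ i * w ^ j := by
  have hc : Commute v w := hA v hv w hw
  let K : Subgroup G :=
    { carrier := {x | ∃ i j : ℤ, x = v ^ i * w ^ j}
      mul_mem' := by
        rintro _ _ ⟨i, j, rfl⟩ ⟨k, l, rfl⟩
        refine ⟨i + k, j + l, ?_⟩
        rw [zpow_add, zpow_add, mul_assoc, mul_assoc, ← mul_assoc (w ^ j),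
          ((hc.zpow_zpow k j).eq).symm, mul_assoc]
      one_mem' := ⟨0, 0, by simp⟩
      inv_mem' := by
        rintro _ ⟨i, j, rfl⟩
        refine ⟨-i, -j, ?_⟩
        rw [mul_inv_rev, zpow_neg, zpow_neg]
        exact ((hc.zpow_zpow i j).inv_inv.eq).symm }
  have hK : K ≤ A := by
    rintro _ ⟨i, j, rfl⟩
    exact mul_mem (zpow_mem hv i) (zpow_mem hw j)
  have h := eq_of_le_of_mem_of_notMem_zpowers A hpow hcard hv hv1 hvw hK
    ⟨1, 0, by simp⟩ ⟨0, 1, by simp⟩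
  rw [← h] at hx
  exact hx

variable [A.Normal]

theorem exists_conj_eq_or_sq_eq_one {g : G} {a : Ω} (hga : g • a = a) (hgv : g * v = v * g) :
    (∃ i : ℤ, MulAut.conj g w = v ^ i * w) ∨ g ^ 2 = 1 := by
  have hφv : MulAut.conj g v = v := by
    rw [MulAut.conj_apply, hgv, mul_inv_cancel_right]
  obtain ⟨i, j, hij⟩ := exists_eq_zpow_mul_zpow A hA hpow hcard hv hv1 hvw hw
    (Subgroup.Normal.conj_mem inferInstance w hw g)
  change MulAut.conj g w = v ^ i * w ^ j at hij
  have hw3 : w ^ (3 : ℤ) = 1 := by exact_mod_cast hpow w hw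
  rw [← Int.emod_add_mul_ediv j 3, zpow_add, zpow_mul, hw3, one_zpow, mul_one] at hij
  have h0 : 0 ≤ j % 3 := Int.emod_nonneg j (by norm_num)
  have h3 : j % 3 < 3 := Int.emod_lt_of_pos j (by norm_num)
  generalize j % 3 = r at hij h0 h3
  interval_cases r
  · exfalso
    apply hvw
    have h1 : MulAut.conj g w = MulAut.conj g (v ^ i) := by
      rw [hij, map_zpow, hφv, zpow_zero, mul_one]
    rw [(MulAut.conj g).injective h1]
    exact Subgroup.zpow_mem_zpowers v i
  · exact Or.inl ⟨i, by rw [hij, zpow_one]⟩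
  · right
    have hvw' : Commute v w := hA v hv w hw
    have hv3 : v ^ (3 : ℤ) = 1 := by exact_mod_cast hpow v hv
    refine eq_one_of_commute_two A hpow hcard hv hv1 hvw hw (a := a) ?_ ?_ ?_
    · rw [pow_two, mul_smul, hga, hga]
    · exact Commute.pow_left hgv 2
    · have : MulAut.conj (g ^ 2) w = w := by
        rw [pow_two, map_mul, MulAut.mul_apply, hij, map_mul, map_zpow, map_zpow, hφv, hij,
          ((hvw'.zpow_zpow i 2).mul_zpow 2), ← mul_assoc, ← zpow_mul, ← zpow_add, ← zpow_mul,
          show i + i * 2 = 3 * i by ring, zpow_mul, hv3, one_zpow, one_mul,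
          show (2 * 2 : ℤ) = 3 + 1 by norm_num, zpow_add, hw3, one_mul, zpow_one]
      exact mul_inv_eq_iff_eq_mul.mp this

theorem pow_six_and_mul_comm_of_commute {a : Ω} :
    (∀ g : G, g • a = a → g * v = v * g → g ^ 6 = 1) ∧
      ∀ g h : G, g • a = a → g * v = v * g → h • a = a → h * v = v * h →
        g ^ 3 = 1 → h ^ 3 = 1 → g * h = h * g := by
  have hφv : ∀ g : G, g * v = v * g → MulAut.conj g v = v := fun g hgv => by
    rw [MulAut.conj_apply, hgv, mul_inv_cancel_right]
  refine ⟨fun g hga hgv => ?_, fun g h hga hgv hha hhv hg3 hh3 => ?_⟩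
  · rcases exists_conj_eq_or_sq_eq_one A hA hpow hcard hv hv1 hvw hw hga hgv with ⟨i, hi⟩ | h
    · have hv3 : v ^ (3 : ℤ) = 1 := by exact_mod_cast hpow v hv
      suffices g ^ 3 = 1 by rw [show 6 = 3 * 2 from rfl, pow_mul, this, one_pow]
      refine eq_one_of_commute_two A hpow hcard hv hv1 hvw hw (a := a) ?_
        (Commute.pow_left hgv 3) ?_
      · simp only [pow_succ, pow_zero, mul_smul, one_smul, hga]
      · have : MulAut.conj (g ^ 3) w = w := by
          simp only [pow_succ, pow_zero, one_mul, map_mul, MulAut.mul_apply, hi, map_zpow,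
            hφv g hgv]
          rw [← mul_assoc, ← mul_assoc, ← zpow_add, ← zpow_add,
            show i + i + i = 3 * i by ring, zpow_mul, hv3, one_zpow, one_mul]
        exact mul_inv_eq_iff_eq_mul.mp this
    · rw [show 6 = 2 * 3 from rfl, pow_mul, h, one_pow]
  · have hone : ∀ x : G, x ^ 3 = 1 → x ^ 2 = 1 → x = 1 := fun x h3 h2 => by
      rwa [pow_succ, h2, one_mul] at h3
    rcases exists_conj_eq_or_sq_eq_one A hA hpow hcard hv hv1 hvw hw hga hgv with ⟨i, hi⟩ | h2
    · rcases exists_conj_eq_or_sq_eq_one A hA hpow hcard hv hv1 hvw hw hha hhv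
        with ⟨k, hk⟩ | h2
      · have h1 : (h * g)⁻¹ * (g * h) = 1 := by
          have hgv' : Commute g v := hgv
          have hhv' : Commute h v := hhv
          refine eq_one_of_commute_two A hpow hcard hv hv1 hvw hw (a := a) ?_
            (((hhv'.mul_left hgv').inv_left).mul_left (hgv'.mul_left hhv')) ?_
          · rw [mul_smul, mul_smul, hha, hga, inv_smul_eq_iff, mul_smul, hga, hha]
          · have : MulAut.conj (g * h) w = MulAut.conj (h * g) w := by
              simp only [map_mul, MulAut.mul_apply, hi, hk, map_zpow, hφv g hgv, hφv h hhv]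
              rw [← mul_assoc, ← mul_assoc, ← zpow_add, ← zpow_add, add_comm]
            have h2 : MulAut.conj ((h * g)⁻¹ * (g * h)) w = w := by
              rw [map_mul, MulAut.mul_apply, this, ← MulAut.mul_apply, ← map_mul,
                inv_mul_cancel, map_one, MulAut.one_apply]
            exact mul_inv_eq_iff_eq_mul.mp h2
        exact (inv_mul_eq_one.mp h1).symm
      · rw [hone h hh3 h2, mul_one, one_mul]
    · rw [hone g hg3 h2, mul_one, one_mul]

end DegreeNine

end Primitive

theorem requiredStructure_stabilizer_of_prime_card [FaithfulSMul G Ω] [Finite Ω]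
    {p : ℕ} (hp : p.Prime) (hp12 : p - 1 ∣ 12) (hΩ : Nat.card Ω = p) (A : Subgroup G) [A.Normal]
    [MulAction.IsPretransitive A Ω] (hA : ∀ x ∈ A, ∀ y ∈ A, x * y = y * x) {Δ : Set Ω}
    (hne : Δ.Nonempty) (huniv : Δ ≠ Set.univ) :
    RequiredStructure (MulAction.stabilizer G Δ) := by
  obtain ⟨u, hu⟩ := hne
  have : Nonempty Ω := ⟨u⟩
  have hcard : Nat.card A = p := (card_eq_of_isPretransitive_of_commute A hA).trans hΩ
  have hinter : ∀ x ∈ A, x ∈ MulAction.stabilizer G Δ → x = 1 := by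
    intro x hx hxΔ
    by_contra hx1
    have hxp : x ^ p = 1 := by
      have := pow_card_eq_one' (x := (⟨x, hx⟩ : A))
      rw [hcard] at this
      exact congrArg Subtype.val this
    have := Fact.mk hp
    have : Finite A := Nat.finite_of_card_ne_zero (hcard ▸ hp.ne_zero)
    have hZ : Subgroup.zpowers x = A := Subgroup.eq_of_le_of_card_ge (Subgroup.zpowers_le.mpr hx)
      (by rw [Nat.card_zpowers, orderOf_eq_prime hxp hx1, hcard])
    have hle : A ≤ MulAction.stabilizer G Δ := hZ ▸ Subgroup.zpowers_le.mpr hxΔ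
    refine huniv (Set.eq_univ_of_forall fun y => ?_)
    obtain ⟨⟨c, hc⟩, hcu : c • u = y⟩ := MulAction.exists_smul_eq A u y
    have hcΔ : c • Δ = Δ := hle hc
    rw [← hcu, ← hcΔ]
    exact Set.smul_mem_smul_set hu
  obtain ⟨hcomm, hpow⟩ := commute_and_pow_of_normal_prime A hp hcard (MulAction.stabilizer G Δ)
    fun x hx hxA => by
      obtain ⟨⟨c, hc⟩, hcu : c • u = x • u⟩ := MulAction.exists_smul_eq A u (x • u)
      have hxc : c⁻¹ * x = 1 := by
        refine eq_one_of_commute_of_isPretransitive A (x := u) (fun d hd => ?_) ?_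
        · have h1 : Commute x d := hxA d hd
          have h2 : Commute c d := hA c hc d hd
          exact h2.inv_left.mul_left h1
        · rw [mul_smul, inv_smul_eq_iff, hcu]
      exact hinter x (inv_mul_eq_one.mp hxc ▸ hc) hx
  refine requiredStructure_of_pow_twelve (fun x => Subtype.ext ?_)
    fun x y _ _ => Subtype.ext (hcomm x x.2 y y.2)
  obtain ⟨k, hk⟩ := hp12
  simp [hk, pow_mul, hpow x x.2]

theorem requiredStructure_stabilizers_of_card_eight [FaithfulSMul G Ω] [Finite G]
    [MulAction.IsPreprimitive G Ω] [Group.IsSolvable G] (hΩ : Nat.card Ω = 8) (A : Subgroup G)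
    [A.Normal] [MulAction.IsPretransitive A Ω] (hA : ∀ x ∈ A, ∀ y ∈ A, x * y = y * x)
    {a b c : Ω} (hab : a ≠ b) (hac : a ≠ c) (hbc : b ≠ c) :
    RequiredStructure (MulAction.stabilizer G ({a, b} : Set Ω)) ∧
      RequiredStructure (MulAction.stabilizer G ({a, b, c} : Set Ω)) := by
  have : Finite Ω := Nat.finite_of_card_ne_zero (by omega)
  have : Nontrivial Ω := ⟨a, b, hab⟩
  have hbot := stabilizer_ne_bot_of_not_prime (G := G) (by rw [hΩ]; norm_num) a
  have : Nontrivial (MulAction.stabilizer G a) := (Subgroup.nontrivial_iff_ne_bot _).mpr hbot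
  obtain ⟨q, B, hq, hBn, hB, hBcomm, hBpow⟩ :=
    exists_normal_comm_pow_eq_one (K := MulAction.stabilizer G a)
  have := Fact.mk hq
  have hq7 : q = 7 := by
    have hBq : IsPGroup q B := fun x => ⟨1, Subtype.ext (by simpa using hBpow x x.2)⟩
    have hmod := hBq.card_modEq_card_fixedPoints Ω
    have hfix : MulAction.fixedPoints B Ω = {a} := by
      ext x
      refine ⟨fun hx => eq_of_fixed_by_normal_subgroup A hA B hB fun b hb => hx ⟨b, hb⟩, ?_⟩
      rintro rfl
      exact fun b => b.1.2
    rw [hfix, hΩ, Nat.card_coe_set_eq, Set.ncard_singleton] at hmod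
    have h7 : q ∣ 7 := (Nat.modEq_iff_dvd' (by norm_num)).mp hmod.symm
    exact (Nat.prime_dvd_prime_iff_eq hq (by norm_num)).mp h7
  subst hq7
  have hfixa : ∀ g : MulAction.stabilizer G a, g • a = a := fun g => g.2
  constructor
  · obtain ⟨hc, hp⟩ :=
      commute_and_pow_of_fixes_one hq hΩ hfixa B hBcomm hBpow hab.symm hB
    refine requiredStructure_stabilizer_pair (fun g hga hgb => ?_)
      fun g h hga hgb hha hhb _ _ => ?_
    · exact congrArg Subtype.val (hp ⟨g, hga⟩ hgb)
    · exact congrArg Subtype.val (hc ⟨g, hga⟩ ⟨h, hha⟩ hgb hhb)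
  · refine requiredStructure_stabilizer_of_ncard_eq_three
      (Set.ncard_eq_three.mpr ⟨a, b, c, hab, hac, hbc, rfl⟩) fun g hg => ?_
    exact congrArg Subtype.val (eq_one_of_fixes_two hq hΩ hfixa B hBcomm hBpow
      (g := ⟨g, hg a (by simp)⟩) hab.symm hac.symm hbc hB (hg b (by simp)) (hg c (by simp)))

theorem exists_stabilizers_of_card_nine [FaithfulSMul G Ω] [Finite G] (hΩ : Nat.card Ω = 9)
    (A : Subgroup G) [A.Normal] [MulAction.IsPretransitive A Ω]
    (hA : ∀ x ∈ A, ∀ y ∈ A, x * y = y * x) (hpow : ∀ x ∈ A, x ^ 3 = 1) (a : Ω) :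
    ∃ b c : Ω, a ≠ b ∧ a ≠ c ∧ b ≠ c ∧
      RequiredStructure (MulAction.stabilizer G ({a, b} : Set Ω)) ∧
      RequiredStructure (MulAction.stabilizer G ({a, b, c} : Set Ω)) := by
  have : Nonempty Ω := ⟨a⟩
  have hcard : Nat.card A = 9 := (card_eq_of_isPretransitive_of_commute A hA).trans hΩ
  obtain ⟨v, hv, hv1⟩ : ∃ v ∈ A, v ≠ 1 := by
    refine (Subgroup.bot_or_exists_ne_one A).resolve_left fun h => ?_
    rw [h, Subgroup.card_bot] at hcard
    omega
  obtain ⟨w, hw, hvw⟩ : ∃ w ∈ A, w ∉ Subgroup.zpowers v := by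
    by_contra! h
    have := Subgroup.card_le_of_le (H := A) (K := Subgroup.zpowers v) h
    rw [hcard, Nat.card_zpowers, orderOf_eq_prime (hpow v hv) hv1] at this
    omega
  have hreg : ∀ x ∈ A, x • a = a → x = 1 := fun x hx hxa =>
    eq_one_of_commute_of_isPretransitive A (hA x hx) hxa
  have hcomm : ∀ x ∈ A, ∀ g : G, g • a = a → g • x • a = x • a → g * x = x * g :=
    fun x hx g hga hgx => mul_comm_of_fixes A hA hx hga hgx
  have hav : a ≠ v • a := fun h => hv1 (hreg v hv h.symm)
  have haw : a ≠ w • a := fun h => hvw (hreg w hw h.symm ▸ one_mem _)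
  have hvwa : v • a ≠ w • a := fun h => by
    have h1 : v⁻¹ * w = 1 := hreg _ (mul_mem (inv_mem hv) hw)
      (by rw [mul_smul, ← h, inv_smul_smul])
    exact hvw (inv_mul_eq_one.mp h1 ▸ Subgroup.mem_zpowers v)
  refine ⟨v • a, w • a, hav, haw, hvwa, ?_, ?_⟩
  · obtain ⟨h6, hc⟩ := pow_six_and_mul_comm_of_commute A hA hpow hcard hv hv1 hvw hw (a := a)
    exact requiredStructure_stabilizer_pair (fun g hga hgv => h6 g hga (hcomm v hv g hga hgv))
      fun g h hga hgv hha hhv => hc g h hga (hcomm v hv g hga hgv) hha (hcomm v hv h hha hhv)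
  · refine requiredStructure_stabilizer_of_ncard_eq_three
      (Set.ncard_eq_three.mpr ⟨_, _, _, hav, haw, hvwa, rfl⟩) fun g hg => ?_
    have hga := hg a (by simp)
    exact eq_one_of_commute_two A hpow hcard hv hv1 hvw hw hga
      (hcomm v hv g hga (hg _ (by simp))) (hcomm w hw g hga (hg _ (by simp)))

theorem requiredStructure_stabilizers_of_card_four [FaithfulSMul G Ω] (hΩ : Nat.card Ω = 4)
    {a b : Ω} (hab : a ≠ b) :
    RequiredStructure (MulAction.stabilizer G ({a} : Set Ω)) ∧
      RequiredStructure (MulAction.stabilizer G ({a, b} : Set Ω)) := by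
  have : Finite Ω := Nat.finite_of_card_ne_zero (by omega)
  constructor
  · rw [← stabilizer_compl (G := G) (α := Ω)]
    refine requiredStructure_stabilizer_of_ncard_eq_three
      (by rw [Set.ncard_compl, Set.ncard_singleton, hΩ]) fun g hg => ?_
    refine eq_of_smul_eq_smul (α := Ω) fun x => ?_
    rw [one_smul]
    by_cases hx : x = a
    · subst hx
      by_contra hne
      exact hne (smul_left_cancel g (hg _ hne))
    · exact hg x hx
  · have hsq : ∀ g : G, g • a = a → g • b = b → g ^ 2 = 1 := by
      intro g ha hb
      have hcard : (({a, b} : Set Ω)ᶜ).ncard = 2 := by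
        rw [Set.ncard_compl, Set.ncard_pair hab, hΩ]
      obtain ⟨c, d, hcd, hcompl⟩ := Set.ncard_eq_two.mp hcard
      have hmem : ∀ x : Ω, x = a ∨ x = b ∨ x = c ∨ x = d := fun x => by
        by_cases h : x ∈ ({a, b} : Set Ω)
        · simp only [Set.mem_insert_iff, Set.mem_singleton_iff] at h
          tauto
        · have h' : x ∈ ({a, b} : Set Ω)ᶜ := h
          rw [hcompl] at h'
          simp only [Set.mem_insert_iff, Set.mem_singleton_iff] at h'
          tauto
      have hinj : ∀ x y : Ω, g • x = g • y → x = y := fun x y h => smul_left_cancel g h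
      refine eq_of_smul_eq_smul (α := Ω) fun x => ?_
      rw [one_smul, pow_two, mul_smul]
      grind [hmem x, hmem (g • x), hmem (g • g • x)]
    refine requiredStructure_stabilizer_pair (fun g ha hb => ?_) fun g h ha hb _ _ hg _ => ?_
    · rw [show 6 = 2 * 3 from rfl, pow_mul, hsq g ha hb, one_pow]
    · rw [pow_succ, hsq g ha hb, one_mul] at hg
      rw [hg, one_mul, mul_one]

end Action

/-- Lemma 2.6: a primitive solvable permutation group of degree between 2 and 9 is nice. -/
theorem stmt_14 {Ω : Type*} [Fintype Ω] (G : Subgroup (Equiv.Perm Ω))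
    (hsolv : IsSolvable G) (hprim : IsPrimitivePermGroup Ω G)
    (h2 : 2 ≤ Fintype.card Ω) (h9 : Fintype.card Ω ≤ 9) :
    IsNice Ω G := by
  have : Group.IsSolvable G := hsolv
  have := hprim.1
  have : MulAction.IsPreprimitive G Ω := ⟨fun {B} hB => hprim.2 B hB⟩
  have : Nontrivial Ω := Fintype.one_lt_card_iff_nontrivial.mp h2
  have : Nontrivial G := by
    obtain ⟨a, b, hab⟩ := exists_pair_ne Ω
    obtain ⟨g, hg⟩ := MulAction.exists_smul_eq G a b
    refine ⟨g, 1, ?_⟩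
    rintro rfl
    exact hab (by rw [← hg, one_smul])
  obtain ⟨p, A, hp, hAn, hAbot, hA, hpow⟩ := exists_normal_comm_pow_eq_one (K := G)
  have := isPretransitive_of_normal_of_ne_bot (Ω := Ω) A hAbot
  have hcardA : Nat.card A = Fintype.card Ω :=
    (card_eq_of_isPretransitive_of_commute (Ω := Ω) A hA).trans Nat.card_eq_fintype_card
  have hdvd : ∀ q : ℕ, q.Prime → q ∣ Fintype.card Ω → q = p := by
    intro q hq hqd
    have := Fact.mk hq
    obtain ⟨d, hd⟩ := exists_prime_orderOf_dvd_card' (G := A) q (hcardA ▸ hqd)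
    have : orderOf d ∣ p := orderOf_dvd_of_pow_eq_one (Subtype.ext (by simpa using hpow d d.2))
    rw [hd] at this
    exact (Nat.prime_dvd_prime_iff_eq hq hp).mp this
  obtain ⟨a, b, hab⟩ := exists_pair_ne Ω
  have h1 : ({a} : Set Ω).ncard = 1 := Set.ncard_singleton a
  have hb2 : ({a, b} : Set Ω).ncard = 2 := Set.ncard_pair hab
  have hthree : ∀ b c : Ω, a ≠ b → a ≠ c → b ≠ c → ({a, b, c} : Set Ω).ncard = 3 :=
    fun b c hab hac hbc => Set.ncard_eq_three.mpr ⟨a, b, c, hab, hac, hbc, rfl⟩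
  have hprime : (Fintype.card Ω).Prime → 5 ≤ Fintype.card Ω → Fintype.card Ω - 1 ∣ 12 →
      IsNice Ω G := by
    intro hΩ h5 h12
    have key : ∀ Δ : Set Ω, Δ.ncard ≠ 0 → Δ.ncard ≤ 2 →
        RequiredStructure (MulAction.stabilizer G Δ) := fun Δ h0 hle => by
      refine requiredStructure_stabilizer_of_prime_card hΩ h12 Nat.card_eq_fintype_card A hA
        (Set.nonempty_of_ncard_ne_zero h0) fun h => ?_
      rw [h, Set.ncard_univ, Nat.card_eq_fintype_card] at hle
      omega
    exact ⟨{a}, {a, b}, by omega, by omega, key _ (by omega) (by omega),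
      key _ (by omega) (by omega)⟩
  have hsmall : Fintype.card Ω ≤ 3 → IsNice Ω G := fun h3 => by
    have h3' : Nat.card Ω ≤ 3 := Nat.card_eq_fintype_card.trans_le h3
    exact ⟨∅, {a}, by simp, by omega, requiredStructure_of_card_le_three h3',
      requiredStructure_of_card_le_three h3'⟩
  have hΩ : Nat.card Ω = Fintype.card Ω := Nat.card_eq_fintype_card
  generalize hn : Fintype.card Ω = n at *
  interval_cases n
  · exact hsmall (by norm_num)
  · exact hsmall (by norm_num)
  · obtain ⟨hs1, hs2⟩ := requiredStructure_stabilizers_of_card_four (G := G) hΩ hab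
    exact ⟨{a}, {a, b}, by omega, by omega, hs1, hs2⟩
  · exact hprime (by norm_num) (by norm_num) (by norm_num)
  · have h2p := hdvd 2 (by norm_num) (by norm_num)
    have h3p := hdvd 3 (by norm_num) (by norm_num)
    omega
  · exact hprime (by norm_num) (by norm_num) (by norm_num)
  · obtain ⟨c, hc⟩ : ∃ c, c ∉ ({a, b} : Set Ω) := by
      by_contra! h
      rw [Set.eq_univ_of_forall h, Set.ncard_univ] at hb2
      omega
    simp only [Set.mem_insert_iff, Set.mem_singleton_iff, not_or] at hc
    obtain ⟨hs2, hs3⟩ := requiredStructure_stabilizers_of_card_eight (G := G) hΩ A hA hab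
      (Ne.symm hc.1) (Ne.symm hc.2)
    have := hthree b c hab (Ne.symm hc.1) (Ne.symm hc.2)
    exact ⟨{a, b}, {a, b, c}, by omega, by omega, hs2, hs3⟩
  · obtain rfl := hdvd 3 (by norm_num) (by norm_num)
    obtain ⟨b, c, hab, hac, hbc, hs2, hs3⟩ :=
      exists_stabilizers_of_card_nine (G := G) hΩ A hA hpow a
    have := hthree b c hab hac hbc
    have := Set.ncard_pair hab
    exact ⟨{a, b}, {a, b, c}, by omega, by omega, hs2, hs3⟩
end
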